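/- arXiv:1801.06754 — 4 statements merged into one kernel-verified Lean document; each statement's English description precedes it below -/
import Mathlib

section
/- Let G be a finite simple graph whose vertex set is partitioned into disjoint sets V_1, ..., V_t, and let c_1, ..., c_t be positive reals such that the sum-color cost of the induced subgraph satisfies ŝ(G[V_i]) ≤ c_i·|V_i| for each i. Then ŝ(G) ≤ ( Σ_{i=1}^{t} c_i )·|V(G)|. -/
open Finset

/-- Auxiliary fuelled recursion for the slow-coloring game value.
`slowAux G n S` computes the value of the slow-coloring game on the
subgraph of `G` induced by the set `S` of (uncolored) vertices, provided
`n ≥ S.card`. -/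
noncomputable def slowAux {V : Type*} [DecidableEq V] (G : SimpleGraph V) :
    ℕ → Finset V → ℕ
  | 0, _ => 0
  | n + 1, S =>
      (S.powerset.filter fun M => M.Nonempty).sup fun M =>
        M.card + sInf {k : ℕ | ∃ X : Finset V, X ⊆ M ∧ X.Nonempty ∧
          (∀ x ∈ X, ∀ y ∈ X, ¬ G.Adj x y) ∧ k = slowAux G n (S \ X)}

/-- The sum-color cost `ŝ(G[S])` of the subgraph of `G` induced by the
vertex set `S`. -/
noncomputable def slowCost {V : Type*} [DecidableEq V] (G : SimpleGraph V)
    (S : Finset V) : ℕ :=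
  slowAux G S.card S

/-- Once the fuel is at least the number of vertices, its amount is irrelevant. -/
theorem slowAux_eq_slowCost {V : Type*} [DecidableEq V] (G : SimpleGraph V) (n : ℕ)
    (S : Finset V) (h : S.card ≤ n) : slowAux G n S = slowCost G S := by
  suffices key : ∀ (n m : ℕ) (S : Finset V), S.card ≤ n → S.card ≤ m →
      slowAux G n S = slowAux G m S from key n S.card S h le_rfl
  have empty : ∀ n, slowAux G n ∅ = 0 := by
    intro n
    cases n with
    | zero => rfl
    | succ n => simp [slowAux, Finset.filter_singleton]
  intro n
  induction n with
  | zero =>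
    intro m S hn _
    obtain rfl : S = ∅ := Finset.card_eq_zero.mp (Nat.le_zero.mp hn)
    rw [empty, empty]
  | succ n ih =>
    intro m S hn hm
    cases m with
    | zero =>
      obtain rfl : S = ∅ := Finset.card_eq_zero.mp (Nat.le_zero.mp hm)
      rw [empty, empty]
    | succ m =>
      simp only [slowAux]
      refine Finset.sup_congr rfl fun M hM => ?_
      have hMS : M ⊆ S := Finset.mem_powerset.mp (Finset.mem_filter.mp hM).1
      congr 2
      ext k
      refine exists_congr fun X => and_congr_right fun hX => and_congr_right fun hne =>
        and_congr_right fun _ => ?_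
      have hlt : (S \ X).card < S.card :=
        Finset.card_lt_card (Finset.sdiff_ssubset (hX.trans hMS) hne)
      rw [ih m (S \ X) (by omega) (by omega)]

/-- The recursion characterizing the sum-color cost. -/
theorem slowCost_eq_sup {V : Type*} [DecidableEq V] (G : SimpleGraph V) (S : Finset V) :
    slowCost G S = (S.powerset.filter fun M => M.Nonempty).sup fun M =>
      M.card + sInf {k : ℕ | ∃ X : Finset V, X ⊆ M ∧ X.Nonempty ∧
        (∀ x ∈ X, ∀ y ∈ X, ¬ G.Adj x y) ∧ k = slowCost G (S \ X)} := by
  rw [← slowAux_eq_slowCost G (S.card + 1) S (Nat.le_succ _), slowAux]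
  simp only [slowAux_eq_slowCost G S.card _ (Finset.card_le_card Finset.sdiff_subset)]

/-- Painter has an optimal reply to every legal move of Lister. -/
theorem exists_reply_slowCost {V : Type*} [DecidableEq V] (G : SimpleGraph V)
    {S M : Finset V} (hMS : M ⊆ S) (hM : M.Nonempty) :
    ∃ X ⊆ M, X.Nonempty ∧ (∀ x ∈ X, ∀ y ∈ X, ¬ G.Adj x y) ∧
      M.card + slowCost G (S \ X) ≤ slowCost G S := by
  have hne : {k : ℕ | ∃ X : Finset V, X ⊆ M ∧ X.Nonempty ∧
      (∀ x ∈ X, ∀ y ∈ X, ¬ G.Adj x y) ∧ k = slowCost G (S \ X)}.Nonempty := by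
    obtain ⟨v, hv⟩ := hM
    exact ⟨_, {v}, by simpa using hv, by simp, by simp, rfl⟩
  obtain ⟨X, hXM, hX, hind, hk⟩ := Nat.sInf_mem hne
  refine ⟨X, hXM, hX, hind, ?_⟩
  rw [← hk, slowCost_eq_sup G S]
  exact Finset.le_sup (f := fun M : Finset V => M.card + sInf {k : ℕ | ∃ X : Finset V,
    X ⊆ M ∧ X.Nonempty ∧ (∀ x ∈ X, ∀ y ∈ X, ¬ G.Adj x y) ∧ k = slowCost G (S \ X)})
    (Finset.mem_filter.mpr ⟨Finset.mem_powerset.mpr hMS, hM⟩)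

/-- A bound that Painter can maintain against every move of Lister bounds the cost. -/
theorem slowCost_le_of_forall_exists_reply {V : Type*} [DecidableEq V] (G : SimpleGraph V)
    {S : Finset V} {b : ℝ} (hb : 0 ≤ b)
    (h : ∀ M ⊆ S, M.Nonempty → ∃ X ⊆ M, X.Nonempty ∧ (∀ x ∈ X, ∀ y ∈ X, ¬ G.Adj x y) ∧
      (M.card : ℝ) + slowCost G (S \ X) ≤ b) :
    (slowCost G S : ℝ) ≤ b := by
  rw [← Nat.le_floor_iff hb, slowCost_eq_sup]
  refine Finset.sup_le fun M hM => ?_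
  rw [Finset.mem_filter, Finset.mem_powerset] at hM
  obtain ⟨X, hXM, hX, hind, hle⟩ := h M hM.1 hM.2
  have hle' : M.card + slowCost G (S \ X) ≤ ⌊b⌋₊ := by
    rw [Nat.le_floor_iff hb]
    exact_mod_cast hle
  refine le_trans (Nat.add_le_add_left (Nat.sInf_le ?_) _) hle'
  exact ⟨X, hXM, hX, hind, rfl⟩

/-- If positive weights `p i` sum to one, then the cost is at most the sum of the costs of the
parts, each divided by its weight. Painter answers optimally inside a part whose share of the
marked vertices is at least its weight. -/
theorem slowCost_le_sum_div {V ι : Type*} [DecidableEq V] [Fintype ι] (G : SimpleGraph V)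
    (P : ι → Finset V) (hdisj : ∀ i j, i ≠ j → Disjoint (P i) (P j))
    (hcover : ∀ v, ∃ i, v ∈ P i) (p : ι → ℝ) (hp : ∀ i, 0 < p i) (hsum : ∑ i, p i = 1)
    (S : Finset V) :
    (slowCost G S : ℝ) ≤ ∑ i, (slowCost G (S ∩ P i) : ℝ) / p i := by
  classical
  induction S using Finset.strongInduction with
  | H S ih =>
    refine slowCost_le_of_forall_exists_reply G
      (Finset.sum_nonneg fun i _ => div_nonneg (Nat.cast_nonneg _) (hp i).le)
      fun M hMS hM => ?_
    have hcard : (M.card : ℝ) ≤ ∑ i, ((M ∩ P i).card : ℝ) := by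
      have hsub : M ⊆ Finset.univ.biUnion fun i => M ∩ P i := fun v hv => by
        simpa [hv] using hcover v
      exact_mod_cast (Finset.card_le_card hsub).trans Finset.card_biUnion_le
    have hMpos : (0 : ℝ) < M.card := by exact_mod_cast hM.card_pos
    obtain ⟨i, hi⟩ : ∃ i, p i * M.card ≤ ((M ∩ P i).card : ℝ) := by
      by_contra! hlt
      obtain ⟨v, -⟩ := hM
      obtain ⟨i, -⟩ := hcover v
      have : ∑ i, ((M ∩ P i).card : ℝ) < ∑ i, p i * M.card :=
        Finset.sum_lt_sum_of_nonempty ⟨i, Finset.mem_univ i⟩ fun j _ => hlt j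
      rw [← Finset.sum_mul, hsum, one_mul] at this
      exact this.not_ge hcard
    have hMi : (M ∩ P i).Nonempty := by
      rw [← Finset.card_pos]
      exact_mod_cast (mul_pos (hp i) hMpos).trans_le hi
    obtain ⟨X, hXM, hX, hind, hle⟩ :=
      exists_reply_slowCost G (Finset.inter_subset_inter_right (u := P i) hMS) hMi
    have hXM' : X ⊆ M := hXM.trans Finset.inter_subset_left
    refine ⟨X, hXM', hX, hind, ?_⟩
    have hrec := ih (S \ X) (Finset.sdiff_ssubset (hXM'.trans hMS) hX)
    rw [← Finset.add_sum_erase _ _ (Finset.mem_univ i)] at hrec ⊢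
    have hother : ∀ j ∈ Finset.univ.erase i, (slowCost G ((S \ X) ∩ P j) : ℝ) / p j =
        (slowCost G (S ∩ P j) : ℝ) / p j := by
      intro j hj
      have hXj : Disjoint (P j) X := (hdisj j i (Finset.ne_of_mem_erase hj)).mono_right
        (hXM.trans Finset.inter_subset_right)
      rw [Finset.inter_comm, ← Finset.inter_sdiff_assoc, Finset.sdiff_eq_self_of_disjoint
        (hXj.mono_left Finset.inter_subset_left), Finset.inter_comm]
    rw [Finset.sum_congr rfl hother] at hrec
    have hsame : (S \ X) ∩ P i = (S ∩ P i) \ X := by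
      ext v
      simp only [Finset.mem_inter, Finset.mem_sdiff]
      tauto
    rw [hsame] at hrec
    have hdrop : (M.card : ℝ) + (slowCost G ((S ∩ P i) \ X) : ℝ) / p i ≤
        (slowCost G (S ∩ P i) : ℝ) / p i := by
      have hle' : ((M ∩ P i).card : ℝ) + slowCost G ((S ∩ P i) \ X) ≤
          slowCost G (S ∩ P i) := by exact_mod_cast hle
      rw [le_div_iff₀ (hp i), add_mul, div_mul_cancel₀ _ (hp i).ne']
      linarith
    linarith

theorem stmt_1 {V : Type*} [Fintype V] [DecidableEq V] (G : SimpleGraph V)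
    (t : ℕ) (Vs : Fin t → Finset V) (c : Fin t → ℝ)
    (hdisj : ∀ i j, i ≠ j → Disjoint (Vs i) (Vs j))
    (hcover : ∀ v : V, ∃ i, v ∈ Vs i)
    (hc : ∀ i, 0 < c i)
    (hbound : ∀ i, (slowCost G (Vs i) : ℝ) ≤ c i * (Vs i).card) :
    (slowCost G Finset.univ : ℝ) ≤ (∑ i, c i) * Fintype.card V := by
  obtain hV | ⟨⟨v⟩⟩ := isEmpty_or_nonempty V
  · simp [slowCost, slowAux]
  obtain ⟨i₀, -⟩ := hcover v
  have hC : 0 < ∑ i, c i := Finset.sum_pos (fun i _ => hc i) ⟨i₀, Finset.mem_univ i₀⟩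
  have hcard : ∑ i, ((Vs i).card : ℝ) = Fintype.card V := by
    have huniv : (Finset.univ.biUnion Vs) = Finset.univ := by
      ext v
      simpa using hcover v
    rw [← Finset.card_univ, ← huniv,
      Finset.card_biUnion fun i _ j _ hij => hdisj i j hij, Nat.cast_sum]
  have hmain := slowCost_le_sum_div G Vs hdisj hcover (fun i => c i / ∑ j, c j)
    (fun i => div_pos (hc i) hC) (by rw [← Finset.sum_div, div_self hC.ne']) Finset.univ
  refine hmain.trans ?_
  rw [← hcard, Finset.mul_sum]
  refine Finset.sum_le_sum fun i _ => ?_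
  rw [Finset.univ_inter, div_le_iff₀ (div_pos (hc i) hC)]
  refine (hbound i).trans_eq ?_
  field_simp [hC.ne']
end

section
/- If the vertex set of a finite simple graph G can be partitioned into t sets each of which induces a forest in G, then the sum-color cost satisfies ŝ(G) ≤ (3t/2)·|V(G)|. -/
open Finset

namespace SlowColoring

variable {V : Type*} [DecidableEq V] {G : SimpleGraph V}

/-- `RootedForest G r S`: the set `S` is assembled from single vertices by repeatedly joining two
disjoint rooted pieces, with at most the edge between their roots connecting them. -/
inductive RootedForest (G : SimpleGraph V) : V → Finset V → Prop
  | single (r : V) : RootedForest G r {r}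
  | join {r c : V} {S T : Finset V} (hS : RootedForest G r S) (hT : RootedForest G c T)
      (hST : Disjoint S T) (hedge : ∀ x ∈ S, ∀ y ∈ T, G.Adj x y → x = r ∧ y = c) :
      RootedForest G r (S ∪ T)

/-- `Pieces G S k`: the set `S` splits into pairwise nonadjacent rooted forests, exactly `k` of
which have odd order. -/
inductive Pieces (G : SimpleGraph V) : Finset V → ℕ → Prop
  | empty : Pieces G ∅ 0
  | add {r : V} {R S : Finset V} {k : ℕ} (hR : RootedForest G r R) (hS : Pieces G S k)
      (hRS : Disjoint R S) (hedge : ∀ x ∈ R, ∀ y ∈ S, ¬ G.Adj x y) :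
      Pieces G (R ∪ S) (#R % 2 + k)

theorem RootedForest.root_mem {r : V} {S : Finset V} (h : RootedForest G r S) : r ∈ S := by
  induction h <;> simp_all

/-- Attaching a new vertex with at most one neighbor keeps a rooted forest. -/
theorem RootedForest.attach {r l : V} {S : Finset V} (h : RootedForest G r S) (hl : l ∉ S)
    (hone : ∀ x ∈ S, ∀ y ∈ S, G.Adj l x → G.Adj l y → x = y) :
    RootedForest G r (insert l S) := by
  induction h with
  | single r =>
    have := RootedForest.join (.single r) (.single l) (by grind [Finset.disjoint_left])
      (G := G) (by simp)
    rwa [Finset.union_comm, ← Finset.insert_eq] at this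
  | @join r c S T hS hT hST hedge ihS ihT =>
    rw [Finset.mem_union, not_or] at hl
    by_cases hcase : ∃ y ∈ T, G.Adj l y
    · obtain ⟨y, hy, hly⟩ := hcase
      rw [← Finset.union_insert]
      refine .join hS (ihT hl.2 fun a ha b hb => hone a (by simp [ha]) b (by simp [hb])) ?_ ?_
      · simp [hST, hl.1]
      · intro a ha b hb hab
        rcases Finset.mem_insert.1 hb with rfl | hb
        · have := hone a (by simp [ha]) y (by simp [hy]) hab.symm hly
          exact absurd hy (this ▸ Finset.disjoint_left.1 hST ha)
        · exact hedge a ha b hb hab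
    · rw [← Finset.insert_union]
      refine .join (ihS hl.1 fun a ha b hb => hone a (by simp [ha]) b (by simp [hb])) hT ?_ ?_
      · simp [hST, hl.2]
      · intro a ha b hb hab
        rcases Finset.mem_insert.1 ha with rfl | ha
        · exact absurd ⟨b, hb, hab⟩ hcase
        · exact hedge a ha b hb hab

theorem Pieces.le_card {S : Finset V} {k : ℕ} (h : Pieces G S k) : k ≤ #S := by
  induction h with
  | empty => simp
  | add hR hS hRS hedge ih =>
    rw [Finset.card_union_of_disjoint hRS]
    exact Nat.add_le_add (Nat.mod_le _ _) ih

theorem Pieces.union {S T : Finset V} {k l : ℕ} (hS : Pieces G S k) (hT : Pieces G T l)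
    (hST : Disjoint S T) (hedge : ∀ x ∈ S, ∀ y ∈ T, ¬ G.Adj x y) :
    Pieces G (S ∪ T) (k + l) := by
  induction hS with
  | empty => simpa using hT
  | add hR hS hRS hRSe ih =>
    rw [Finset.disjoint_union_left] at hST
    rw [Finset.union_assoc, add_assoc]
    refine .add hR (ih hST.2 fun x hx => hedge x (by simp [hx]))
      (Finset.disjoint_union_right.2 ⟨hRS, hST.1⟩) fun x hx y hy => ?_
    rcases Finset.mem_union.1 hy with hy | hy
    · exact hRSe x hx y hy
    · exact hedge x (by simp [hx]) y hy

theorem RootedForest.pieces {r : V} {S : Finset V} (h : RootedForest G r S) :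
    Pieces G S (#S % 2) := by
  simpa using Pieces.add h .empty (Finset.disjoint_empty_right S) (by simp)

/-- A legal answer of Painter to the marked set `M` inside `P`. -/
structure Legal (G : SimpleGraph V) (M P X : Finset V) : Prop where
  subset : X ⊆ P
  marked : X ⊆ M
  indep : ∀ x ∈ X, ∀ y ∈ X, ¬ G.Adj x y

/-- Painter has an answer to `M` in `P` containing `r`, with surplus at least `a`. -/
def TakesRoot (G : SimpleGraph V) (M : Finset V) (r : V) (P : Finset V) (a : ℤ) : Prop :=
  ∃ X k, Legal G M P X ∧ r ∈ X ∧ Pieces G (P \ X) k ∧ 2 * (#(M ∩ P) : ℤ) + a ≤ 3 * #X + k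

/-- Painter has an answer to `M` in `P` avoiding `r`, with surplus at least `d`. -/
def AvoidsRoot (G : SimpleGraph V) (M : Finset V) (r : V) (P : Finset V) (d : ℤ) : Prop :=
  ∃ X k, Legal G M P X ∧ r ∉ X ∧ Pieces G (P \ X) k ∧ 2 * (#(M ∩ P) : ℤ) + d ≤ 3 * #X + k

/-- Painter has an answer to `M` in `P` avoiding `r`, after which the piece rooted at `r` has
order of the parity of `p`; the surplus, in which this piece is not counted, is at least `b`. -/
def KeepsRoot (G : SimpleGraph V) (M : Finset V) (r : V) (P : Finset V) (p : ℕ) (b : ℤ) : Prop :=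
  ∃ X R Q k, Legal G M P X ∧ P \ X = R ∪ Q ∧ Disjoint R Q ∧ (∀ x ∈ R, ∀ y ∈ Q, ¬ G.Adj x y) ∧
    RootedForest G r R ∧ Pieces G Q k ∧ #R % 2 = p % 2 ∧ 2 * (#(M ∩ P) : ℤ) + b ≤ 3 * #X + k

variable {M P T : Finset V} {r c : V}

theorem TakesRoot.mono {a b : ℤ} (h : TakesRoot G M r P a) (hab : b ≤ a) :
    TakesRoot G M r P b := by
  obtain ⟨X, k, h₁, h₂, h₃, h₄⟩ := h
  exact ⟨X, k, h₁, h₂, h₃, by omega⟩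

theorem KeepsRoot.mono {p q : ℕ} {a b : ℤ} (h : KeepsRoot G M r P p a) (hpq : p % 2 = q % 2)
    (hab : b ≤ a) : KeepsRoot G M r P q b := by
  obtain ⟨X, R, Q, k, h₁, h₂, h₃, h₄, h₅, h₆, h₇, h₈⟩ := h
  exact ⟨X, R, Q, k, h₁, h₂, h₃, h₄, h₅, h₆, by omega, by omega⟩

theorem KeepsRoot.avoidsRoot {p : ℕ} {b d : ℤ} (h : KeepsRoot G M r P p b)
    (hd : d ≤ b + (p % 2 : ℕ)) : AvoidsRoot G M r P d := by
  obtain ⟨X, R, Q, k, h₁, h₂, h₃, h₄, h₅, h₆, h₇, h₈⟩ := h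
  refine ⟨X, #R % 2 + k, h₁, fun hr => ?_, h₂ ▸ .add h₅ h₆ h₃ h₄, by omega⟩
  have : r ∈ P \ X := h₂ ▸ Finset.mem_union_left Q h₅.root_mem
  exact (Finset.mem_sdiff.1 this).2 hr

theorem card_inter_union (h : Disjoint P T) : #(M ∩ (P ∪ T)) = #(M ∩ P) + #(M ∩ T) := by
  rw [Finset.inter_union_distrib_left, Finset.card_union_of_disjoint
    (h.mono Finset.inter_subset_right Finset.inter_subset_right)]

theorem union_sdiff_union {X Y : Finset V} (h : Disjoint P T) (hX : X ⊆ P) (hY : Y ⊆ T) :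
    (P ∪ T) \ (X ∪ Y) = (P \ X) ∪ (T \ Y) := by
  rw [Finset.disjoint_left] at h
  grind

/-- The common hypothesis of the joining lemmas: only the edge `r c` may connect `P` and `T`. -/
def OnlyEdge (G : SimpleGraph V) (r c : V) (P T : Finset V) : Prop :=
  Disjoint P T ∧ ∀ x ∈ P, ∀ y ∈ T, G.Adj x y → x = r ∧ y = c

theorem Legal.union {X Y : Finset V} (hPT : OnlyEdge G r c P T) (hX : Legal G M P X)
    (hY : Legal G M T Y) (hrc : r ∉ X ∨ c ∉ Y) : Legal G M (P ∪ T) (X ∪ Y) := by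
  refine ⟨Finset.union_subset_union hX.subset hY.subset,
    Finset.union_subset hX.marked hY.marked, ?_⟩
  have key : ∀ x ∈ X, ∀ y ∈ Y, ¬ G.Adj x y := fun x hx y hy hxy => by
    obtain ⟨rfl, rfl⟩ := hPT.2 x (hX.subset hx) y (hY.subset hy) hxy
    exact hrc.elim (· hx) (· hy)
  intro x hx y hy hxy
  rcases Finset.mem_union.1 hx with hx | hx <;> rcases Finset.mem_union.1 hy with hy | hy
  · exact hX.indep x hx y hy hxy
  · exact key x hx y hy hxy
  · exact key y hy x hx hxy.symm
  · exact hY.indep x hx y hy hxy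

theorem TakesRoot.join {a d : ℤ} (hPT : OnlyEdge G r c P T) (hP : TakesRoot G M r P a)
    (hT : AvoidsRoot G M c T d) : TakesRoot G M r (P ∪ T) (a + d) := by
  obtain ⟨X, k, hX, hrX, hk, ha⟩ := hP
  obtain ⟨Y, l, hY, hcY, hl, hd⟩ := hT
  have hXY := hPT.1.mono hX.subset hY.subset
  refine ⟨X ∪ Y, k + l, hX.union hPT hY (.inr hcY), by simp [hrX], ?_, ?_⟩
  · rw [union_sdiff_union hPT.1 hX.subset hY.subset]
    refine hk.union hl (hPT.1.mono Finset.sdiff_subset Finset.sdiff_subset) fun x hx y hy hxy => ?_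
    rw [Finset.mem_sdiff] at hx hy
    exact hx.2 ((hPT.2 x hx.1 y hy.1 hxy).1 ▸ hrX)
  · rw [card_inter_union hPT.1, Finset.card_union_of_disjoint hXY]
    push_cast
    linarith

theorem KeepsRoot.join_takesRoot {p : ℕ} {a b : ℤ} (hPT : OnlyEdge G r c P T)
    (hP : KeepsRoot G M r P p b) (hT : TakesRoot G M c T a) :
    KeepsRoot G M r (P ∪ T) p (b + a) := by
  obtain ⟨X, R, Q, k, hX, hRQ, hdisj, hadj, hR, hQ, hp, hb⟩ := hP
  obtain ⟨Y, l, hY, hcY, hl, ha⟩ := hT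
  have hXY := hPT.1.mono hX.subset hY.subset
  have hmem : ∀ x, x ∈ R ∨ x ∈ Q → x ∈ P ∧ x ∉ X := fun x hx =>
    Finset.mem_sdiff.1 (hRQ ▸ Finset.mem_union.2 hx)
  have hsep : ∀ x, x ∈ R ∨ x ∈ Q → ∀ y ∈ T \ Y, ¬ G.Adj x y := fun x hx y hy hxy => by
    rw [Finset.mem_sdiff] at hy
    exact hy.2 ((hPT.2 x (hmem x hx).1 y hy.1 hxy).2 ▸ hcY)
  have hout : ∀ x, x ∈ R ∨ x ∈ Q → x ∉ T \ Y := fun x hx hy =>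
    Finset.disjoint_left.1 hPT.1 (hmem x hx).1 (Finset.mem_sdiff.1 hy).1
  refine ⟨X ∪ Y, R, Q ∪ T \ Y, k + l,
    hX.union hPT hY (.inl fun h => (hmem r (.inl hR.root_mem)).2 h), ?_, ?_, ?_, hR, ?_, hp, ?_⟩
  · rw [union_sdiff_union hPT.1 hX.subset hY.subset, hRQ, Finset.union_assoc]
  · exact Finset.disjoint_union_right.2
      ⟨hdisj, Finset.disjoint_left.2 fun x hx => hout x (.inl hx)⟩
  · intro x hx y hy
    rcases Finset.mem_union.1 hy with hy | hy
    · exact hadj x hx y hy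
    · exact hsep x (.inl hx) y hy
  · exact hQ.union hl (Finset.disjoint_left.2 fun x hx => hout x (.inr hx))
      fun x hx => hsep x (.inr hx)
  · rw [card_inter_union hPT.1, Finset.card_union_of_disjoint hXY]
    push_cast
    linarith

theorem KeepsRoot.join_keepsRoot {p q : ℕ} {a b : ℤ} (hPT : OnlyEdge G r c P T)
    (hP : KeepsRoot G M r P p b) (hT : KeepsRoot G M c T q a) :
    KeepsRoot G M r (P ∪ T) (p + q) (b + a) := by
  obtain ⟨X, R, Q, k, hX, hRQ, hdisj, hadj, hR, hQ, hp, hb⟩ := hP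
  obtain ⟨Y, R', Q', l, hY, hRQ', hdisj', hadj', hR', hQ', hq, ha⟩ := hT
  have hXY := hPT.1.mono hX.subset hY.subset
  have hmem : ∀ x, x ∈ R ∨ x ∈ Q → x ∈ P ∧ x ∉ X := fun x hx =>
    Finset.mem_sdiff.1 (hRQ ▸ Finset.mem_union.2 hx)
  have hmem' : ∀ x, x ∈ R' ∨ x ∈ Q' → x ∈ T ∧ x ∉ Y := fun x hx =>
    Finset.mem_sdiff.1 (hRQ' ▸ Finset.mem_union.2 hx)
  have hPTd := Finset.disjoint_left.1 hPT.1
  have hdl := Finset.disjoint_left.1 hdisj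
  have hdl' := Finset.disjoint_left.1 hdisj'
  have hr := hR.root_mem
  have hc := hR'.root_mem
  have hRR' : Disjoint R R' := Finset.disjoint_left.2 fun x hx hx' =>
    hPTd (hmem x (.inl hx)).1 (hmem' x (.inl hx')).1
  have hcross : ∀ x, x ∈ R ∨ x ∈ Q → ∀ y, y ∈ R' ∨ y ∈ Q' → G.Adj x y → x = r ∧ y = c :=
    fun x hx y hy => hPT.2 x (hmem x hx).1 y (hmem' y hy).1
  refine ⟨X ∪ Y, R ∪ R', Q ∪ Q', k + l, hX.union hPT hY (.inl (hmem r (.inl hr)).2), ?_, ?_, ?_,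
    hR.join hR' hRR' fun x hx y hy => hcross x (.inl hx) y (.inl hy), ?_, ?_, ?_⟩
  · rw [union_sdiff_union hPT.1 hX.subset hY.subset, hRQ, hRQ', Finset.union_union_union_comm]
  · rw [Finset.disjoint_left]
    grind
  · intro x hx y hy hxy
    have := hxy.symm
    grind
  · refine hQ.union hQ' (Finset.disjoint_left.2 fun x hx hx' =>
      hPTd (hmem x (.inr hx)).1 (hmem' x (.inr hx')).1) fun x hx y hy hxy => ?_
    have := hcross x (.inr hx) y (.inr hy) hxy
    exact hdl hr (this.1 ▸ hx)
  · rw [Finset.card_union_of_disjoint hRR']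
    omega
  · rw [card_inter_union hPT.1, Finset.card_union_of_disjoint hXY]
    push_cast
    linarith

/-- The possible guarantees for Painter in a rooted forest. -/
def Guarantee (G : SimpleGraph V) (M : Finset V) (r : V) (P : Finset V) : Prop :=
  (∃ b : ℤ, 0 ≤ b ∧ b ≤ 1 ∧ (b + #P) % 2 = 1 ∧ KeepsRoot G M r P 1 b) ∨
  (∃ b : ℤ, 0 ≤ b ∧ b ≤ 1 ∧ (b + #P) % 2 = 0 ∧ KeepsRoot G M r P 0 b) ∨
  (∃ a : ℤ, 0 ≤ a ∧ a ≤ 1 ∧ (a + #P) % 2 = 0 ∧ TakesRoot G M r P a ∧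
    KeepsRoot G M r P 1 (-1 - a)) ∨
  (∃ a : ℤ, 1 ≤ a ∧ a ≤ 2 ∧ (a + #P) % 2 = 0 ∧ TakesRoot G M r P a ∧ KeepsRoot G M r P 0 (-a))

/-- What a joined piece contributes: either it flips the parity of the piece at the root, or not. -/
theorem Guarantee.contribution (h : Guarantee G M c T) :
    (∃ b : ℤ, 0 ≤ b ∧ b ≤ 1 ∧ (b + #T) % 2 = 1 ∧ KeepsRoot G M c T 1 b ∧
      AvoidsRoot G M c T (b + 1)) ∨
    (∃ a : ℤ, 0 ≤ a ∧ a ≤ 2 ∧ (a + #T) % 2 = 0 ∧ (TakesRoot G M c T a ∨ KeepsRoot G M c T 0 a) ∧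
      AvoidsRoot G M c T (-a)) := by
  rcases h with ⟨b, h0, h1, hp, h⟩ | ⟨b, h0, h1, hp, h⟩ | ⟨a, h0, h1, hp, h, h'⟩ |
    ⟨a, h0, h1, hp, h, h'⟩
  · exact .inl ⟨b, h0, h1, hp, h, h.avoidsRoot (by simp)⟩
  · exact .inr ⟨b, h0, by omega, hp, .inr h, h.avoidsRoot (by simp; omega)⟩
  · exact .inr ⟨a, h0, by omega, hp, .inl h, h'.avoidsRoot (by simp; omega)⟩
  · exact .inr ⟨a, by omega, h1, hp, .inl h, h'.avoidsRoot (by simp)⟩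

theorem Guarantee.join (hPT : OnlyEdge G r c P T) (hP : Guarantee G M r P)
    (hT : Guarantee G M c T) : Guarantee G M r (P ∪ T) := by
  have hcard : (#(P ∪ T) : ℤ) = #P + #T := by
    rw [Finset.card_union_of_disjoint hPT.1]
    push_cast
    rfl
  rw [Guarantee, hcard]
  rcases hT.contribution with ⟨e, he0, he1, hep, hk, hd⟩ | ⟨e, he0, he1, hep, hk, hd⟩
  · rcases hP with ⟨b, h0, h1, hp, h⟩ | ⟨b, h0, h1, hp, h⟩ | ⟨a, h0, h1, hp, h, h'⟩ |
      ⟨a, h0, h1, hp, h, h'⟩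
    · exact .inr <| .inl ⟨(b + e) % 2, by omega, by omega, by omega,
        (h.join_keepsRoot hPT hk).mono rfl (by omega)⟩
    · exact .inl ⟨(b + e) % 2, by omega, by omega, by omega,
        (h.join_keepsRoot hPT hk).mono rfl (by omega)⟩
    · exact .inr <| .inr <| .inr ⟨2 - (a + e + 1) % 2, by omega, by omega, by omega,
        (h.join hPT hd).mono (by omega), (h'.join_keepsRoot hPT hk).mono rfl (by omega)⟩
    · exact .inr <| .inr <| .inl ⟨(a + e + 1) % 2, by omega, by omega, by omega,
        (h.join hPT hd).mono (by omega), (h'.join_keepsRoot hPT hk).mono rfl (by omega)⟩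
  · have hkeep : ∀ {p : ℕ} {b : ℤ}, KeepsRoot G M r P p b → KeepsRoot G M r (P ∪ T) p (b + e) :=
      fun h => hk.elim (h.join_takesRoot hPT) (h.join_keepsRoot hPT)
    rcases hP with ⟨b, h0, h1, hp, h⟩ | ⟨b, h0, h1, hp, h⟩ | ⟨a, h0, h1, hp, h, h'⟩ |
      ⟨a, h0, h1, hp, h, h'⟩
    · exact .inl ⟨(b + e) % 2, by omega, by omega, by omega, (hkeep h).mono rfl (by omega)⟩
    · exact .inr <| .inl ⟨(b + e) % 2, by omega, by omega, by omega,
        (hkeep h).mono rfl (by omega)⟩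
    · by_cases hae : e ≤ a
      · exact .inr <| .inr <| .inl ⟨a - e, by omega, by omega, by omega,
          (h.join hPT hd).mono (by omega), (hkeep h').mono rfl (by omega)⟩
      · exact .inl ⟨e - a - 1, by omega, by omega, by omega, (hkeep h').mono rfl (by omega)⟩
    · by_cases hae : e < a
      · exact .inr <| .inr <| .inr ⟨a - e, by omega, by omega, by omega,
          (h.join hPT hd).mono (by omega), (hkeep h').mono rfl (by omega)⟩
      · exact .inr <| .inl ⟨e - a, by omega, by omega, by omega, (hkeep h').mono rfl (by omega)⟩

theorem RootedForest.guarantee (h : RootedForest G r P) (M : Finset V) : Guarantee G M r P := by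
  induction h with
  | join hS hT hST hedge ihS ihT => exact ihS.join ⟨hST, hedge⟩ ihT
  | single r =>
    have hempty : Legal G M {r} ∅ := ⟨by simp, by simp, by simp⟩
    by_cases hr : r ∈ M
    · refine .inr <| .inr <| .inl ⟨1, by norm_num, by norm_num, by simp,
        ⟨{r}, 0, ⟨by simp, by simpa, by simp⟩, by simp, by simpa using Pieces.empty, ?_⟩,
        ⟨∅, {r}, ∅, 0, hempty, by simp, by simp, by simp, .single r, .empty, by simp, ?_⟩⟩ <;>
      simp [Finset.inter_singleton_of_mem hr]
    · refine .inl ⟨0, by norm_num, by norm_num, by simp,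
        ⟨∅, {r}, ∅, 0, hempty, by simp, by simp, by simp, .single r, .empty, by simp, ?_⟩⟩
      simp [Finset.inter_singleton_of_notMem hr]

theorem RootedForest.exists_answer (h : RootedForest G r P) (M : Finset V) :
    ∃ X k, Legal G M P X ∧ Pieces G (P \ X) k ∧ 2 * #(M ∩ P) + #P % 2 ≤ 3 * #X + k := by
  have main : ∀ a : ℤ, (#P % 2 : ℤ) ≤ a → (TakesRoot G M r P a ∨ AvoidsRoot G M r P a) →
      ∃ X k, Legal G M P X ∧ Pieces G (P \ X) k ∧ 2 * #(M ∩ P) + #P % 2 ≤ 3 * #X + k := by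
    rintro a ha (⟨X, k, hX, -, hk, hle⟩ | ⟨X, k, hX, -, hk, hle⟩) <;>
      exact ⟨X, k, hX, hk, by omega⟩
  rcases (h.guarantee M) with ⟨b, h0, h1, hp, h⟩ | ⟨b, h0, h1, hp, h⟩ | ⟨a, h0, h1, hp, h, -⟩ |
    ⟨a, h0, h1, hp, h, -⟩
  · exact main (b + 1) (by omega) (.inr (h.avoidsRoot (by simp)))
  · exact main b (by omega) (.inr (h.avoidsRoot (by simp)))
  · exact main a (by omega) (.inl h)
  · exact main a (by omega) (.inl h)

theorem Pieces.exists_answer {S : Finset V} {k : ℕ} (h : Pieces G S k) (M : Finset V) :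
    ∃ X l, Legal G M S X ∧ Pieces G (S \ X) l ∧ 2 * #(M ∩ S) + k ≤ 3 * #X + l := by
  induction h with
  | empty => exact ⟨∅, 0, ⟨by simp, by simp, by simp⟩, by simpa using Pieces.empty, by simp⟩
  | @add r R S k hR hS hRS hedge ih =>
    obtain ⟨X, i, hX, hi, hle⟩ := hR.exists_answer M
    obtain ⟨Y, j, hY, hj, hle'⟩ := ih
    have hne : OnlyEdge G r r R S := ⟨hRS, fun x hx y hy hxy => absurd hxy (hedge x hx y hy)⟩
    refine ⟨X ∪ Y, i + j, hX.union hne hY ?_, ?_, ?_⟩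
    · exact .inr fun h => Finset.disjoint_left.1 hRS hR.root_mem (hY.subset h)
    · rw [union_sdiff_union hRS hX.subset hY.subset]
      exact hi.union hj (hRS.mono Finset.sdiff_subset Finset.sdiff_subset) fun x hx y hy =>
        hedge x (Finset.mem_sdiff.1 hx).1 y (Finset.mem_sdiff.1 hy).1
    · rw [card_inter_union hRS, Finset.card_union_of_disjoint (hRS.mono hX.subset hY.subset)]
      omega

/-- If the answer is empty, it yields a decomposition with more odd pieces, so we try again. -/
theorem Pieces.exists_nonempty_answer {S : Finset V} {k : ℕ} (h : Pieces G S k) (M : Finset V)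
    (hM : (M ∩ S).Nonempty) : ∃ X l, X.Nonempty ∧ Legal G M S X ∧ Pieces G (S \ X) l ∧
      2 * #(M ∩ S) + k ≤ 3 * #X + l := by
  induction hd : #S - k using Nat.strong_induction_on generalizing k with
  | _ d ih =>
    obtain ⟨X, l, hX, hl, hle⟩ := h.exists_answer M
    rcases X.eq_empty_or_nonempty with rfl | hne
    · rw [Finset.sdiff_empty] at hl
      rw [Finset.card_empty] at hle
      have := hM.card_pos
      have := hl.le_card
      obtain ⟨Y, m, hne, hY, hm, hle'⟩ := ih (#S - l) (by omega) hl rfl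
      exact ⟨Y, m, hne, hY, hm, by omega⟩
    · exact ⟨X, l, hne, hX, hl, hle⟩

theorem exists_subsingleton_neighbors {W : Type*} [Finite W] [Nonempty W] {H : SimpleGraph W}
    (h : H.IsAcyclic) : ∃ u, ∀ v w, H.Adj u v → H.Adj u w → v = w := by
  obtain ⟨u, v, p, hp, hmax⟩ := SimpleGraph.Walk.exists_isPath_forall_isPath_length_le_length H
  have key : ∀ w, H.Adj u w → w = p.snd := fun w hadj => by
    refine h.eq_snd_of_adj_start hp hadj ?_
    by_contra hw
    have := hmax _ _ _ (hp.cons (h := hadj.symm) hw)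
    simp at this
  exact ⟨u, fun v w hv hw => (key v hv).trans (key w hw).symm⟩

theorem exists_rootedForest (S : Finset V) (hS : S.Nonempty)
    (hacyc : (G.induce (↑S : Set V)).IsAcyclic) : ∃ r, RootedForest G r S := by
  induction S using Finset.strongInduction with
  | H S ih =>
    have : Nonempty (↑S : Set V) := hS.to_subtype
    obtain ⟨⟨l, hl⟩, hone⟩ := exists_subsingleton_neighbors hacyc
    rw [Finset.mem_coe] at hl
    rcases (S.erase l).eq_empty_or_nonempty with h | h
    · refine ⟨l, ?_⟩
      rw [← Finset.insert_erase hl, h]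
      exact .single l
    · obtain ⟨r, hr⟩ := ih _ (Finset.erase_ssubset hl) h
        (hacyc.embedding (SimpleGraph.induceHomOfLE G (by simp)))
      refine ⟨r, ?_⟩
      rw [← Finset.insert_erase hl]
      refine hr.attach (by simp) fun x hx y hy hlx hly => ?_
      simpa using hone ⟨x, Finset.mem_of_mem_erase hx⟩ ⟨y, Finset.mem_of_mem_erase hy⟩ hlx hly

theorem exists_pieces (S : Finset V) (hacyc : (G.induce (↑S : Set V)).IsAcyclic) :
    ∃ k, Pieces G S k := by
  rcases S.eq_empty_or_nonempty with rfl | h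
  · exact ⟨0, .empty⟩
  · obtain ⟨r, hr⟩ := exists_rootedForest S h hacyc
    exact ⟨_, hr.pieces⟩

theorem card_eq_sum_inter {t : ℕ} {Vs : Fin t → Finset V}
    (hdisj : ∀ i j, i ≠ j → Disjoint (Vs i) (Vs j)) (hcover : ∀ v : V, ∃ i, v ∈ Vs i)
    (S : Finset V) : #S = ∑ i, #(S ∩ Vs i) := by
  rw [← Finset.card_biUnion fun i _ j _ hij =>
    (hdisj i j hij).mono Finset.inter_subset_right Finset.inter_subset_right]
  congr 1
  ext v
  simpa using fun _ => hcover v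

/-- Painter plays in the part containing the most marked vertices. -/
theorem two_mul_slowAux_add_le {t : ℕ} {Vs : Fin t → Finset V}
    (hdisj : ∀ i j, i ≠ j → Disjoint (Vs i) (Vs j)) (hcover : ∀ v : V, ∃ i, v ∈ Vs i) (n : ℕ)
    (S : Finset V) (k : Fin t → ℕ) (hk : ∀ i, Pieces G (S ∩ Vs i) (k i)) :
    2 * slowAux G n S + t * ∑ i, k i ≤ 3 * t * #S := by
  induction n generalizing S k with
  | zero =>
    have hle : ∑ i, k i ≤ #S :=
      card_eq_sum_inter hdisj hcover S ▸ Finset.sum_le_sum fun i _ => (hk i).le_card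
    have := Nat.mul_le_mul_left t hle
    simp only [slowAux]
    linarith [Nat.zero_le (t * #S)]
  | succ n ih =>
    have hle : ∑ i, k i ≤ #S :=
      card_eq_sum_inter hdisj hcover S ▸ Finset.sum_le_sum fun i _ => (hk i).le_card
    suffices slowAux G (n + 1) S ≤ (3 * t * #S - t * ∑ i, k i) / 2 by
      have := Nat.mul_le_mul_left t hle
      have : 3 * t * #S = 3 * (t * #S) := by ring
      omega
    rw [slowAux]
    refine Finset.sup_le fun M hM => ?_
    rw [Finset.mem_filter, Finset.mem_powerset] at hM
    obtain ⟨hMS, hM⟩ := hM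
    obtain ⟨i, hi⟩ : ∃ i, #M ≤ t * #(M ∩ Vs i) := by
      by_contra! hlt
      obtain ⟨v, -⟩ := hM
      obtain ⟨i, -⟩ := hcover v
      have := Finset.sum_lt_sum_of_nonempty ⟨i, Finset.mem_univ i⟩ fun j _ => hlt j
      rw [← Finset.mul_sum, ← card_eq_sum_inter hdisj hcover M] at this
      simp at this
    have hMi : M ∩ (S ∩ Vs i) = M ∩ Vs i := by
      rw [← Finset.inter_assoc, Finset.inter_eq_left.2 hMS]
    obtain ⟨X, l, hne, hX, hl, hXl⟩ := (hk i).exists_nonempty_answer M <| hMi ▸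
      Finset.card_pos.1 (Nat.pos_of_mul_pos_left (hM.card_pos.trans_le hi))
    rw [hMi] at hXl
    have hXS : X ⊆ S := hX.subset.trans Finset.inter_subset_left
    have hXi : X ⊆ Vs i := hX.subset.trans Finset.inter_subset_right
    have hpieces : ∀ j, Pieces G ((S \ X) ∩ Vs j) (Function.update k i l j) := by
      intro j
      rcases eq_or_ne j i with rfl | hj
      · rw [Function.update_self, Finset.sdiff_inter_right_comm]
        exact hl
      · rw [Function.update_of_ne hj, Finset.sdiff_inter_right_comm,
          Finset.sdiff_eq_self_of_disjoint]
        · exact hk j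
        · exact (hdisj j i hj).mono Finset.inter_subset_right hXi
    have hrec := ih (S \ X) _ hpieces
    have hinf : sInf {m : ℕ | ∃ X : Finset V, X ⊆ M ∧ X.Nonempty ∧
        (∀ x ∈ X, ∀ y ∈ X, ¬ G.Adj x y) ∧ m = slowAux G n (S \ X)} ≤ slowAux G n (S \ X) :=
      Nat.sInf_le ⟨X, hX.marked, hne, hX.indep, rfl⟩
    have hcard : #(S \ X) + #X = #S := Finset.card_sdiff_add_card_eq_card hXS
    have hsum : ∑ j, Function.update k i l j + k i = ∑ j, k j + l := by
      rw [Finset.sum_update_of_mem (Finset.mem_univ i),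
        ← Finset.add_sum_erase _ k (Finset.mem_univ i), Finset.sdiff_singleton_eq_erase]
      ring
    have hgain := Nat.mul_le_mul_left t hXl
    refine (Nat.add_le_add_left hinf _).trans ((Nat.le_div_iff_mul_le two_pos).2 ?_)
    refine Nat.le_sub_of_add_le ?_
    rw [← hcard]
    have hsum' := congrArg (t * ·) hsum
    simp only [mul_add] at hsum' hgain ⊢
    linarith

end SlowColoring

theorem stmt_3 {V : Type*} [Fintype V] [DecidableEq V] (G : SimpleGraph V)
    (t : ℕ) (Vs : Fin t → Finset V)
    (hdisj : ∀ i j, i ≠ j → Disjoint (Vs i) (Vs j))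
    (hcover : ∀ v : V, ∃ i, v ∈ Vs i)
    (hforest : ∀ i, (G.induce (↑(Vs i) : Set V)).IsAcyclic) :
    (slowCost G Finset.univ : ℝ) ≤ (3 * t / 2 : ℝ) * Fintype.card V := by
  choose k hk using fun i => SlowColoring.exists_pieces (Vs i) (hforest i)
  have h := SlowColoring.two_mul_slowAux_add_le hdisj hcover (#(univ : Finset V)) univ k
    (by simpa using hk)
  have h' : 2 * slowCost G univ ≤ 3 * t * Fintype.card V := (Nat.le_add_right _ _).trans h
  have : (2 * slowCost G univ : ℝ) ≤ 3 * t * Fintype.card V := mod_cast h'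
  linarith
end

section
/- Let G be an acyclically k-colorable finite simple graph with n vertices. If k is even, then the sum-color cost satisfies ŝ(G) ≤ (3k/4)·n; if k is odd, then ŝ(G) ≤ ((3k+1)/4)·n. -/
open Finset

/-- A graph is acyclically `k`-colorable if it has a proper coloring with `k`
colors in which the union of any two color classes induces a forest. -/
def AcyclicallyColorable {W : Type*} (G : SimpleGraph W) (k : ℕ) : Prop :=
  ∃ f : W → Fin k, (∀ u v, G.Adj u v → f u ≠ f v) ∧
    ∀ i j : Fin k, (G.induce {v : W | f v = i ∨ f v = j}).IsAcyclic

/-! ### Leaf-elimination orders of forests -/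

theorem SimpleGraph.IsAcyclic.exists_forall_adj_eq {W : Type*} [Finite W] [Nonempty W]
    {H : SimpleGraph W} (hH : H.IsAcyclic) : ∃ v p : W, ∀ w, H.Adj v w → w = p := by
  classical
  have := Fintype.ofFinite W
  obtain ⟨u, v, q, hq, hmax⟩ := SimpleGraph.Walk.exists_isPath_forall_isPath_length_le_length H
  refine ⟨u, q.snd, fun w hw => hH.eq_snd_of_adj_start hq hw ?_⟩
  by_contra hws
  have := hmax _ _ _ (hq.cons (h := hw.symm) hws)
  simp at this

/-- A finite set spanning a forest can be listed so that each of its vertices has at most one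
later neighbor, namely its parent. -/
theorem exists_elimination_order {V : Type*} [DecidableEq V] (G : SimpleGraph V) (A : Finset V)
    (hA : (G.induce (A : Set V)).IsAcyclic) :
    ∃ (L : List V) (par : V → V), L.Nodup ∧ (∀ v, v ∈ L ↔ v ∈ A) ∧
      L.Pairwise fun u w => G.Adj u w → w = par u := by
  induction A using Finset.strongInduction with
  | H A ih =>
    rcases A.eq_empty_or_nonempty with rfl | hne
    · exact ⟨[], id, by simp⟩
    have : Nonempty (A : Set V) := hne.to_subtype
    obtain ⟨⟨v, hv⟩, ⟨p, hp⟩, hvp⟩ := hA.exists_forall_adj_eq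
    have hv' : v ∈ A := hv
    obtain ⟨L, par, hnd, hmem, hpar⟩ := ih (A.erase v) (Finset.erase_ssubset hv')
      (hA.embedding (SimpleGraph.induceHomOfLE G
        (by simp)))
    refine ⟨v :: L, Function.update par v p, ?_, ?_, ?_⟩
    · simp [hnd, hmem]
    · intro w
      by_cases hw : w = v <;> simp [hw, hmem, hv']
    · refine List.pairwise_cons.2 ⟨fun w hw hadj => ?_, hpar.imp_of_mem ?_⟩
      · have hwA : w ∈ A := Finset.mem_of_mem_erase ((hmem w).1 hw)
        simpa using hvp ⟨w, hwA⟩ (by simpa using hadj)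
      · intro a b ha _ h hab
        have hav : a ≠ v := Finset.ne_of_mem_erase ((hmem a).1 ha)
        simpa [hav] using h hab

/-! ### Odd components -/

/-- The number of components of odd total weight in the forest induced by `S` on the vertices
listed in `L`, where `par` gives the parent of each vertex (if it comes later in `L`). -/
def oddCount {V : Type*} [DecidableEq V] (par : V → V) : List V → Finset V → (V → ℕ) → ℕ
  | [], _, _ => 0
  | v :: L, S, t =>
      if v ∈ S then
        if par v ∈ L ∧ par v ∈ S then
          oddCount par L S (Function.update t (par v) (t (par v) + t v))
        else t v % 2 + oddCount par L S t
      else oddCount par L S t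

theorem List.sum_map_add_eq_of_forall_ne {α M : Type*} [AddCommGroup M] {L : List α}
    (hL : L.Nodup) {p : α} (hp : p ∈ L) (f g : α → M) (h : ∀ w ∈ L, w ≠ p → f w = g w) :
    (L.map f).sum = (L.map g).sum + f p - g p := by
  induction L with
  | nil => simp at hp
  | cons a L ih =>
    obtain ⟨ha, hL⟩ := List.nodup_cons.1 hL
    by_cases hap : a = p
    · subst hap
      have : L.map f = L.map g := List.map_congr_left fun w hw =>
        h w (List.mem_cons_of_mem _ hw) (by rintro rfl; exact ha hw)
      simp only [List.map_cons, List.sum_cons, this]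
      abel
    · have hpL : p ∈ L := by simpa [Ne.symm hap] using hp
      have := ih hL hpL fun w hw => h w (List.mem_cons_of_mem _ hw)
      simp only [List.map_cons, List.sum_cons, this, h a (by simp) hap]
      abel

section oddCount

variable {V : Type*} [DecidableEq V] (par : V → V)

theorem oddCount_congr {L : List V} {S T : Finset V} {s t : V → ℕ}
    (h : ∀ v ∈ L, (v ∈ S ↔ v ∈ T) ∧ (v ∈ T → s v % 2 = t v % 2)) :
    oddCount par L S s = oddCount par L T t := by
  induction L generalizing s t with
  | nil => rfl
  | cons v L ih =>
    obtain ⟨hv, hvt⟩ := h v (by simp)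
    have hL : ∀ w ∈ L, (w ∈ S ↔ w ∈ T) ∧ (w ∈ T → s w % 2 = t w % 2) :=
      fun w hw => h w (List.mem_cons_of_mem _ hw)
    have hp : (par v ∈ L ∧ par v ∈ S) ↔ (par v ∈ L ∧ par v ∈ T) :=
      and_congr_right fun hp => (hL _ hp).1
    simp only [oddCount, hv, hp, ih hL]
    split_ifs with h₁ h₂
    · refine ih fun w hw => ⟨(hL w hw).1, fun hwT => ?_⟩
      have := (hL w hw).2 hwT
      have := hvt h₁
      by_cases hwp : w = par v
      · subst hwp
        simp only [Function.update_self]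
        omega
      · simpa [hwp] using (hL w hw).2 hwT
    · rw [hvt h₁]
    · rfl

theorem oddCount_le_sum {L : List V} (hL : L.Nodup) (S : Finset V) (t : V → ℕ) :
    (oddCount par L S t : ℤ) ≤ (L.map fun v => if v ∈ S then (t v : ℤ) else 0).sum := by
  induction L generalizing t with
  | nil => simp [oddCount]
  | cons v L ih =>
    obtain ⟨hv, hL⟩ := List.nodup_cons.1 hL
    simp only [oddCount, List.map_cons, List.sum_cons]
    split_ifs with h₁ h₂
    · have h := ih hL (Function.update t (par v) (t (par v) + t v))
      rw [List.sum_map_add_eq_of_forall_ne hL h₂.1 _ (fun w => if w ∈ S then (t w : ℤ) else 0)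
        (by intro w _ hw; simp [hw])] at h
      simp only [h₂.2, if_true, Function.update_self] at h
      push_cast at h
      linarith
    · have h := ih hL t
      have : t v % 2 ≤ t v := Nat.mod_le _ _
      push_cast
      omega
    · simpa using ih hL t

/-- The contribution of `v` to the score of the response `X` to the marked set `M`. -/
def responseScore (S M X : Finset V) (b t : V → ℕ) (v : V) : ℤ :=
  if v ∈ X then 1 - b v + ((1 + t v) % 2 : ℕ)
  else if v ∈ S then b v - (if v ∈ M then 2 else 0) else 0

theorem exists_response (G : SimpleGraph V) {L : List V} (hL : L.Nodup)
    (hadj : L.Pairwise fun u w => G.Adj u w → w = par u) {S M : Finset V} (hMS : M ⊆ S)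
    (b t : V → ℕ) :
    ∃ X : Finset V, X ⊆ M ∧ (∀ v ∈ X, v ∈ L) ∧ (∀ x ∈ X, ∀ y ∈ X, ¬ G.Adj x y) ∧
      (oddCount par L S (fun v => t v + b v) : ℤ) ≤
        (L.map (responseScore S M X b t)).sum + oddCount par L (S \ X) t := by
  induction L generalizing b t with
  | nil => exact ⟨∅, by simp [oddCount]⟩
  | cons v L ih =>
    obtain ⟨hvL, hL⟩ := List.nodup_cons.1 hL
    obtain ⟨hvadj, hadj⟩ := List.pairwise_cons.1 hadj
    have ih := ih hL hadj
    have map_insert : ∀ X : Finset V, ∀ b t : V → ℕ,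
        L.map (responseScore S M (insert v X) b t) = L.map (responseScore S M X b t) := by
      intro X b t
      refine List.map_congr_left fun w hw => ?_
      have : w ≠ v := by rintro rfl; exact hvL hw
      simp [responseScore, this]
    have odd_insert : ∀ X : Finset V, ∀ t : V → ℕ,
        oddCount par L (S \ insert v X) t = oddCount par L (S \ X) t := by
      intro X t
      refine oddCount_congr par fun w hw => ⟨?_, fun _ => rfl⟩
      have : w ≠ v := by rintro rfl; exact hvL hw
      simp [this]
    have indep_insert : ∀ X : Finset V, (∀ x ∈ X, x ∈ L) → par v ∉ X →
        (∀ x ∈ X, ∀ y ∈ X, ¬ G.Adj x y) →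
        ∀ x ∈ insert v X, ∀ y ∈ insert v X, ¬ G.Adj x y := by
      intro X hXL hp hX x hx y hy hxy
      rcases Finset.mem_insert.1 hx with hx | hx <;> rcases Finset.mem_insert.1 hy with hy | hy
      · exact hxy.ne (hx.trans hy.symm)
      · exact hp (hvadj y (hXL y hy) (hx ▸ hxy) ▸ hy)
      · exact hp (hvadj x (hXL x hx) (hy ▸ hxy.symm) ▸ hx)
      · exact hX x hx y hy hxy
    by_cases hvS : v ∈ S
    swap
    · obtain ⟨X, hXM, hXL, hXi, hX⟩ := ih b t
      have hvX : v ∉ X := fun h => hvS (hMS (hXM h))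
      refine ⟨X, hXM, fun x hx => List.mem_cons_of_mem _ (hXL x hx), hXi, ?_⟩
      simpa [oddCount, hvS, responseScore, hvX] using hX
    by_cases hp : par v ∈ L ∧ par v ∈ S
    · have hpv : par v ≠ v := by intro h; exact hvL (h ▸ hp.1)
      by_cases hjoin : v ∈ M ∧ b v ≤ 1
      · -- `v` is colored unless its parent is
        obtain ⟨X, hXM, hXL, hXi, hX⟩ := ih
          (Function.update b (par v) (b (par v) + (1 + (1 + t v) % 2 - b v))) t
        have hvX : v ∉ X := fun h => hvL (hXL v h)
        rw [List.sum_map_add_eq_of_forall_ne hL hp.1 _ (responseScore S M X b t)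
          (by intro w _ hw; simp [responseScore, hw])] at hX
        have hodd : oddCount par L S (Function.update (fun v => t v + b v) (par v)
            (t (par v) + b (par v) + (t v + b v))) = oddCount par L S (fun w => t w +
            Function.update b (par v) (b (par v) + (1 + (1 + t v) % 2 - b v)) w) := by
          refine oddCount_congr par fun w _ => ⟨Iff.rfl, fun _ => ?_⟩
          by_cases hw : w = par v
          · subst hw; simp only [Function.update_self]; omega
          · simp [hw]
        by_cases hpX : par v ∈ X
        · refine ⟨X, hXM, fun x hx => List.mem_cons_of_mem _ (hXL x hx), hXi, ?_⟩
          simp only [oddCount, hvS, hp, hvX, hpX, if_true, if_false, and_self, hodd,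
            List.map_cons, List.sum_cons, Finset.mem_sdiff, not_true, not_false_iff, and_false]
          simp only [responseScore, hpX, hvX, hvS, hjoin.1, if_true, if_false,
            Function.update_self] at hX ⊢
          push_cast at hX ⊢
          omega
        · refine ⟨insert v X, Finset.insert_subset hjoin.1 hXM, ?_,
            indep_insert X hXL hpX hXi, ?_⟩
          · intro x hx
            rcases Finset.mem_insert.1 hx with rfl | hx
            · simp
            · exact List.mem_cons_of_mem _ (hXL x hx)
          rw [List.map_cons, map_insert]
          simp only [oddCount, hvS, hp, if_true, and_self, hodd, odd_insert, if_false,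
            List.sum_cons, Finset.mem_sdiff, Finset.mem_insert_self, not_true, and_false]
          simp only [responseScore, hpX, hp.2, Finset.mem_insert_self, if_true, if_false,
            Function.update_self] at hX ⊢
          push_cast at hX ⊢
          omega
      · -- `v` is not colored
        set c : ℕ := b v - (if v ∈ M then 2 else 0) with hc
        have hcb : (c : ℤ) = b v - (if v ∈ M then 2 else 0) := by
          rw [hc]; split_ifs with h
          · have : ¬ b v ≤ 1 := fun h' => hjoin ⟨h, h'⟩
            omega
          · simp
        have hcp : c % 2 = b v % 2 := by split_ifs at hcb <;> omega
        obtain ⟨X, hXM, hXL, hXi, hX⟩ := ih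
          (Function.update b (par v) (b (par v) + c))
          (Function.update t (par v) (t (par v) + t v))
        have hvX : v ∉ X := fun h => hvL (hXL v h)
        rw [List.sum_map_add_eq_of_forall_ne hL hp.1 _ (responseScore S M X b t)
          (by intro w _ hw; simp [responseScore, hw])] at hX
        have hodd : oddCount par L S (Function.update (fun v => t v + b v) (par v)
            (t (par v) + b (par v) + (t v + b v))) = oddCount par L S (fun w =>
            Function.update t (par v) (t (par v) + t v) w +
            Function.update b (par v) (b (par v) + c) w) := by
          refine oddCount_congr par fun w _ => ⟨Iff.rfl, fun _ => ?_⟩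
          by_cases hw : w = par v
          · subst hw; simp only [Function.update_self]; omega
          · simp [hw]
        refine ⟨X, hXM, fun x hx => List.mem_cons_of_mem _ (hXL x hx), hXi, ?_⟩
        by_cases hpX : par v ∈ X
        · have hupd : oddCount par L (S \ X) (Function.update t (par v) (t (par v) + t v)) =
              oddCount par L (S \ X) t := by
            refine oddCount_congr par fun w _ => ⟨Iff.rfl, fun hw => ?_⟩
            have : w ≠ par v := by rintro rfl; exact (Finset.mem_sdiff.1 hw).2 hpX
            simp [this]
          simp only [oddCount, hvS, hp, hvX, hpX, if_true, if_false, and_self, hodd,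
            List.map_cons, List.sum_cons, Finset.mem_sdiff, not_true, not_false_iff, and_false]
          simp only [responseScore, hpX, hvX, hvS, if_true, if_false,
            Function.update_self, ← hcb, hupd] at hX ⊢
          push_cast at hX ⊢
          omega
        · simp only [oddCount, hvS, hp, hvX, hpX, if_true, and_self, hodd,
            List.map_cons, List.sum_cons, Finset.mem_sdiff, not_false_iff]
          simp only [responseScore, hpX, hvX, hvS, hp.2, if_true, if_false,
            Function.update_self, ← hcb] at hX ⊢
          push_cast at hX ⊢
          omega
    · obtain ⟨X, hXM, hXL, hXi, hX⟩ := ih b t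
      have hvX : v ∉ X := fun h => hvL (hXL v h)
      have hpX : par v ∉ X := fun h => hp ⟨hXL _ h, hMS (hXM h)⟩
      have hp' : ¬ (par v ∈ L ∧ par v ∈ S \ X) :=
        fun h => hp ⟨h.1, (Finset.mem_sdiff.1 h.2).1⟩
      by_cases hjoin : v ∈ M ∧ b v ≤ 1
      · refine ⟨insert v X, Finset.insert_subset hjoin.1 hXM, ?_,
          indep_insert X hXL hpX hXi, ?_⟩
        · intro x hx
          rcases Finset.mem_insert.1 hx with rfl | hx
          · simp
          · exact List.mem_cons_of_mem _ (hXL x hx)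
        rw [List.map_cons, map_insert]
        simp only [oddCount, hvS, hp, if_true, odd_insert, if_false,
          List.sum_cons, Finset.mem_sdiff, Finset.mem_insert_self, not_true, and_false]
        simp only [responseScore, Finset.mem_insert_self, if_true] at hX ⊢
        push_cast at hX ⊢
        omega
      · refine ⟨X, hXM, fun x hx => List.mem_cons_of_mem _ (hXL x hx), hXi, ?_⟩
        have hvSX : v ∈ S \ X := Finset.mem_sdiff.2 ⟨hvS, hvX⟩
        simp only [oddCount, hvS, hp, hvSX, hp', if_true, if_false, List.map_cons, List.sum_cons]
        have hb : v ∈ M → 2 ≤ b v := fun h => by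
          by_contra h'
          exact hjoin ⟨h, by omega⟩
        rw [show responseScore S M X b t v = b v - (if v ∈ M then 2 else 0) by
          simp [responseScore, hvX, hvS]]
        push_cast at hX ⊢
        split_ifs with h
        · have := hb h
          omega
        · omega

end oddCount

/-! ### Combining potentials -/

/-- Painter can play on the subgraph induced by `A` following a potential that is at most `c` per
vertex. -/
def HasPotential {V : Type*} [DecidableEq V] (G : SimpleGraph V) (A : Finset V) (c : ℝ) : Prop :=
  ∃ P : Finset V → ℝ, (∀ S ⊆ A, 0 ≤ P S ∧ P S ≤ c * S.card) ∧
    ∀ S ⊆ A, ∀ M ⊆ S, M.Nonempty → ∃ X ⊆ M, X.Nonempty ∧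
      (∀ x ∈ X, ∀ y ∈ X, ¬ G.Adj x y) ∧ M.card + P (S \ X) ≤ P S

section HasPotential

variable {V : Type*} [DecidableEq V] {G : SimpleGraph V}

theorem hasPotential_of_independent {A : Finset V} (hA : ∀ x ∈ A, ∀ y ∈ A, ¬ G.Adj x y) :
    HasPotential G A 1 := by
  refine ⟨fun S => S.card, fun S _ => by simp, fun S hS M hM hne =>
    ⟨M, subset_rfl, hne, fun x hx y hy => hA x (hS (hM hx)) y (hS (hM hy)), ?_⟩⟩
  simp only
  rw [Finset.cast_card_sdiff hM]
  linarith

theorem hasPotential_of_isAcyclic {A : Finset V} (hA : (G.induce (A : Set V)).IsAcyclic) :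
    HasPotential G A (3 / 2) := by
  obtain ⟨L, par, hnd, hmem, hpar⟩ := exists_elimination_order G A hA
  have hsum : ∀ f : V → ℤ, (L.map f).sum = ∑ v ∈ A, f v := by
    intro f
    rw [← List.sum_toFinset f hnd]
    congr 1
    ext v
    simp [hmem]
  refine ⟨fun S => (3 * S.card - oddCount par L S fun _ => 1) / 2, fun S hS => ?_,
    fun S hS M hM hne => ?_⟩
  · have h := oddCount_le_sum par hnd S fun _ => 1
    rw [hsum, Finset.sum_ite_mem, Finset.inter_eq_right.2 hS] at h
    simp only [Nat.cast_one, Finset.sum_const, mul_one, nsmul_eq_mul] at h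
    have h' : (oddCount par L S (fun _ => 1) : ℝ) ≤ S.card := by exact_mod_cast h
    have : (0 : ℝ) ≤ oddCount par L S (fun _ => 1) := by positivity
    constructor <;> linarith
  · obtain ⟨X, hXM, -, hXi, hX⟩ := exists_response par G hnd hpar hM (fun _ => 0) fun _ => 1
    have hscore : ∀ v ∈ A, responseScore S M X (fun _ => 0) (fun _ => 1) v =
        3 * (if v ∈ X then 1 else 0) - 2 * (if v ∈ M then 1 else 0) := by
      intro v _
      simp only [responseScore]
      by_cases h₁ : v ∈ X
      · simp [h₁, hXM h₁]
      · by_cases h₂ : v ∈ M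
        · simp [h₁, h₂, hM h₂]
        · simp [h₁, h₂]
    rw [hsum, Finset.sum_congr rfl hscore, Finset.sum_sub_distrib, ← Finset.mul_sum,
      ← Finset.mul_sum, Finset.sum_ite_mem, Finset.sum_ite_mem,
      Finset.inter_eq_right.2 ((hXM.trans hM).trans hS),
      Finset.inter_eq_right.2 (hM.trans hS)] at hX
    simp only [add_zero, Finset.sum_const, nsmul_eq_mul, mul_one] at hX
    have hX' : (oddCount par L S (fun _ => 1) : ℝ) ≤
        3 * X.card - 2 * M.card + oddCount par L (S \ X) (fun _ => 1) := by exact_mod_cast hX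
    have hle : 3 * (S.card : ℝ) - (oddCount par L S fun _ => 1) ≥
        2 * M.card + (3 * (S \ X).card - (oddCount par L (S \ X) fun _ => 1)) := by
      rw [Finset.cast_card_sdiff (hXM.trans hM)]
      linarith
    refine ⟨X, hXM, ?_, hXi, by simp only; linarith⟩
    rw [Finset.nonempty_iff_ne_empty]
    rintro rfl
    have : (0 : ℝ) < M.card := by exact_mod_cast hne.card_pos
    simp at hle
    linarith

theorem slowAux_le_of_potential (P : Finset V → ℝ) (hP : ∀ S, 0 ≤ P S)
    (hreply : ∀ S : Finset V, ∀ M ⊆ S, M.Nonempty → ∃ X ⊆ M, X.Nonempty ∧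
      (∀ x ∈ X, ∀ y ∈ X, ¬ G.Adj x y) ∧ M.card + P (S \ X) ≤ P S) (n : ℕ) (S : Finset V) :
    (slowAux G n S : ℝ) ≤ P S := by
  induction n generalizing S with
  | zero => simpa [slowAux] using hP S
  | succ n ih =>
    rw [← Nat.le_floor_iff (hP S), slowAux]
    refine Finset.sup_le fun M hM => ?_
    obtain ⟨hMS, hne⟩ := Finset.mem_filter.1 hM
    obtain ⟨X, hXM, hXne, hXi, hX⟩ := hreply S M (Finset.mem_powerset.1 hMS) hne
    have hle : M.card + slowAux G n (S \ X) ≤ ⌊P S⌋₊ := by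
      rw [Nat.le_floor_iff (hP S)]
      push_cast
      linarith [ih (S \ X)]
    refine le_trans (Nat.add_le_add_left (Nat.sInf_le ?_) _) hle
    exact ⟨X, hXM, hXne, hXi, rfl⟩

/-- If the vertices are partitioned into parts that have potentials, then Painter can always answer
on a part whose share of the marked set is proportional to its cost. -/
theorem slowCost_univ_le_sum [Fintype V] {ι : Type*} [Fintype ι] [DecidableEq ι] (g : V → ι)
    (c : ι → ℝ) (hc : ∀ j, 0 < c j)
    (h : ∀ j, HasPotential G (Finset.univ.filter fun v => g v = j) (c j)) :
    (slowCost G Finset.univ : ℝ) ≤ (∑ j, c j) * Fintype.card V := by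
  choose P hP hreply using h
  set W := ∑ j, c j with hW
  have hW0 : 0 ≤ W := Finset.sum_nonneg fun j _ => (hc j).le
  have hsub : ∀ (S : Finset V) j,
      (S.filter fun v => g v = j) ⊆ Finset.univ.filter fun v => g v = j :=
    fun S j => Finset.filter_subset_filter _ (Finset.subset_univ S)
  have hcard : ∀ M : Finset V, (M.card : ℝ) = ∑ j, ((M.filter fun v => g v = j).card : ℝ) := by
    intro M
    exact_mod_cast Finset.card_eq_sum_card_fiberwise fun v _ => Finset.mem_univ (g v)
  refine (slowAux_le_of_potential
    (fun S => ∑ j, W / c j * P j (S.filter fun v => g v = j)) ?_ ?_ _ _).trans ?_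
  · exact fun S => Finset.sum_nonneg fun j _ =>
      mul_nonneg (div_nonneg hW0 (hc j).le) (hP j _ (hsub S j)).1
  · intro S M hMS hne
    have hM0 : (0 : ℝ) < M.card := by exact_mod_cast hne.card_pos
    obtain ⟨j, hj⟩ : ∃ j, c j * M.card ≤ W * (M.filter fun v => g v = j).card := by
      by_contra! hlt
      obtain ⟨v, -⟩ := hne
      have := Finset.sum_lt_sum_of_nonempty ⟨g v, Finset.mem_univ _⟩ fun j _ => hlt j
      rw [← Finset.mul_sum, ← hcard, ← Finset.sum_mul] at this
      exact lt_irrefl _ this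
    have hWj : 0 < W * (M.filter fun v => g v = j).card := (mul_pos (hc j) hM0).trans_le hj
    have hjne : (M.filter fun v => g v = j).Nonempty := by
      rw [Finset.nonempty_iff_ne_empty]
      intro h0
      simp [h0] at hWj
    obtain ⟨X, hXM, hXne, hXi, hX⟩ := hreply j (S.filter fun v => g v = j) (hsub S j)
      (M.filter fun v => g v = j) (Finset.filter_subset_filter _ hMS) hjne
    refine ⟨X, hXM.trans (Finset.filter_subset _ _), hXne, hXi, ?_⟩
    have hother : ∀ i ∈ Finset.univ.erase j,
        W / c i * P i ((S \ X).filter fun v => g v = i) =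
        W / c i * P i (S.filter fun v => g v = i) := by
      intro i hi
      congr 2
      ext v
      simp only [Finset.mem_filter, Finset.mem_sdiff]
      have : v ∈ X → g v = j := fun hv => (Finset.mem_filter.1 (hXM hv)).2
      have := Finset.ne_of_mem_erase hi
      grind
    have hself : ((S \ X).filter fun v => g v = j) = (S.filter fun v => g v = j) \ X := by
      ext v
      simp only [Finset.mem_filter, Finset.mem_sdiff]
      tauto
    rw [← Finset.add_sum_erase _ _ (Finset.mem_univ j), Finset.sum_congr rfl hother,
      ← Finset.add_sum_erase (Finset.univ : Finset ι)
        (fun j => W / c j * P j (S.filter fun v => g v = j)) (Finset.mem_univ j), hself]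
    have hM : (M.card : ℝ) ≤ W / c j * (M.filter fun v => g v = j).card := by
      rw [div_mul_eq_mul_div, le_div_iff₀ (hc j)]
      linarith
    have := mul_le_mul_of_nonneg_left hX (div_nonneg hW0 (hc j).le)
    rw [mul_add] at this
    linarith
  · rw [← Finset.card_univ, hcard, Finset.mul_sum]
    refine Finset.sum_le_sum fun j _ => ?_
    have := mul_le_mul_of_nonneg_left (hP j _ (hsub Finset.univ j)).2 (div_nonneg hW0 (hc j).le)
    rwa [← mul_assoc, div_mul_cancel₀ _ (hc j).ne'] at this

end HasPotential

theorem stmt_7 {V : Type*} [Fintype V] [DecidableEq V] (G : SimpleGraph V)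
    (k : ℕ) (hacyc : AcyclicallyColorable G k) :
    (Even k →
      (slowCost G Finset.univ : ℝ) ≤ (3 * k / 4 : ℝ) * Fintype.card V) ∧
    (Odd k →
      (slowCost G Finset.univ : ℝ) ≤ ((3 * k + 1) / 4 : ℝ) * Fintype.card V) := by
  obtain ⟨f, hproper, hforest⟩ := hacyc
  have hpair : ∀ {ι : Type} [DecidableEq ι] (g : V → ι) (a : ι) (i j : Fin k),
      (∀ v, g v = a → f v = i ∨ f v = j) →
      HasPotential G (Finset.univ.filter fun v => g v = a) (3 / 2) := by
    intro ι _ g a i j h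
    refine hasPotential_of_isAcyclic ((hforest i j).embedding
      (SimpleGraph.induceHomOfLE G fun v hv => h v ?_))
    simpa using hv
  constructor
  · rintro ⟨m, rfl⟩
    have hf : ∀ v, (f v : ℕ) / 2 < m := fun v => by have := (f v).2; omega
    have h := slowCost_univ_le_sum (G := G) (fun v => (⟨(f v : ℕ) / 2, hf v⟩ : Fin m))
      (fun _ => 3 / 2) (fun _ => by norm_num) fun a =>
        hpair _ a ⟨2 * a, by omega⟩ ⟨2 * a + 1, by omega⟩ fun v hv => by
          simp only [Fin.ext_iff] at hv ⊢
          omega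
    refine h.trans_eq ?_
    simp only [Finset.sum_const, Finset.card_univ, Fintype.card_fin, nsmul_eq_mul]
    push_cast
    ring
  · rintro ⟨m, rfl⟩
    let g : V → Option (Fin m) := fun v =>
      if h : (f v : ℕ) / 2 < m then some ⟨(f v : ℕ) / 2, h⟩ else none
    have h := slowCost_univ_le_sum (G := G) g (fun a => a.elim 1 fun _ => 3 / 2)
      (fun a => by cases a <;> norm_num) fun a => by
        cases a with
        | none =>
          refine hasPotential_of_independent fun x hx y hy hxy => hproper x y hxy ?_
          have hlast : ∀ z, g z = none → (f z : ℕ) = 2 * m := by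
            intro z hz
            have := (f z).2
            have : ¬ (f z : ℕ) / 2 < m := by
              intro hlt
              simp [g, hlt] at hz
            omega
          simp only [Finset.mem_filter] at hx hy
          rw [Fin.ext_iff, hlast x hx.2, hlast y hy.2]
        | some a =>
          refine hpair g (some a) ⟨2 * a, by omega⟩ ⟨2 * a + 1, by omega⟩ fun v hv => ?_
          simp only [g] at hv
          split_ifs at hv
          simp only [Option.some.injEq, Fin.ext_iff] at hv ⊢
          omega
    refine h.trans_eq ?_
    simp only [Fintype.sum_option, Option.elim, Finset.sum_const, Finset.card_univ,
      Fintype.card_fin, nsmul_eq_mul]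
    push_cast
    ring
end

section
/- If G is an acyclically k-colorable finite simple graph with n vertices, where k is odd, then the sum-color cost satisfies ŝ(G) ≤ (1/k)·( √(3/4)·(k−1) + 1 )²·n. -/
open Finset

section

variable {V : Type*} {G : SimpleGraph V}

/-- `X` is an independent set of `G`. -/
def IndepOn (G : SimpleGraph V) (X : Finset V) : Prop :=
  ∀ x ∈ X, ∀ y ∈ X, ¬ G.Adj x y

/-- No edge of `G` joins `A` and `B`. -/
def NonAdj (G : SimpleGraph V) (A B : Finset V) : Prop :=
  ∀ x ∈ A, ∀ y ∈ B, ¬ G.Adj x y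

theorem IndepOn.singleton (G : SimpleGraph V) (x : V) : IndepOn G {x} := by
  intro a ha b hb
  rw [Finset.mem_singleton.1 ha, Finset.mem_singleton.1 hb]
  exact G.loopless.irrefl x

theorem NonAdj.mono {A B A' B' : Finset V} (h : NonAdj G A B) (hA : A' ⊆ A) (hB : B' ⊆ B) :
    NonAdj G A' B' :=
  fun x hx y hy => h x (hA hx) y (hB hy)

/-- The only edge of `G` that may join `A` and `B` is `vc`. -/
def OnlyEdge (G : SimpleGraph V) (A B : Finset V) (v c : V) : Prop :=
  ∀ x ∈ A, ∀ y ∈ B, G.Adj x y → x = v ∧ y = c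

theorem OnlyEdge.nonAdj_left {A B A' B' : Finset V} {v c : V} (h : OnlyEdge G A B v c) (hA : A' ⊆ A)
    (hB : B' ⊆ B) (hv : v ∉ A') : NonAdj G A' B' :=
  fun x hx y hy hxy => hv ((h x (hA hx) y (hB hy) hxy).1 ▸ hx)

theorem OnlyEdge.nonAdj_right {A B A' B' : Finset V} {v c : V} (h : OnlyEdge G A B v c) (hA : A' ⊆ A)
    (hB : B' ⊆ B) (hc : c ∉ B') : NonAdj G A' B' :=
  fun x hx y hy hxy => hc ((h x (hA hx) y (hB hy) hxy).2 ▸ hy)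

theorem NonAdj.symm {A B : Finset V} (h : NonAdj G A B) : NonAdj G B A :=
  fun x hx y hy hxy => h y hy x hx hxy.symm

variable [DecidableEq V]

theorem IndepOn.union {X Y : Finset V} (hX : IndepOn G X) (hY : IndepOn G Y)
    (hXY : NonAdj G X Y) : IndepOn G (X ∪ Y) := by
  intro a ha b hb hab
  rcases Finset.mem_union.1 ha with ha | ha <;> rcases Finset.mem_union.1 hb with hb | hb
  · exact hX a ha b hb hab
  · exact hXY a ha b hb hab
  · exact hXY b hb a ha hab.symm
  · exact hY a ha b hb hab

/-! ### The value of the game -/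

theorem slowAux_empty (G : SimpleGraph V) (n : ℕ) : slowAux G n ∅ = 0 := by
  cases n with
  | zero => rfl
  | succ n =>
    simp only [slowAux]
    rw [Finset.filter_eq_empty_iff.2]
    · rfl
    · intro M hM
      simp_all

theorem slowAux_eq_of_card_le (G : SimpleGraph V) (n m : ℕ) (S : Finset V) (hn : S.card ≤ n)
    (hm : S.card ≤ m) : slowAux G n S = slowAux G m S := by
  induction n generalizing m S with
  | zero =>
    obtain rfl : S = ∅ := by simpa using hn
    simp [slowAux_empty]
  | succ n ih =>
    cases m with
    | zero =>
      obtain rfl : S = ∅ := by simpa using hm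
      simp [slowAux_empty]
    | succ m =>
      simp only [slowAux]
      refine Finset.sup_congr rfl fun M hM => ?_
      rw [Finset.mem_filter, Finset.mem_powerset] at hM
      congr 2
      ext k
      refine exists_congr fun X => and_congr_right fun hX => and_congr_right fun hne =>
        and_congr_right fun _ => ?_
      have hlt : (S \ X).card < S.card :=
        Finset.card_lt_card (Finset.sdiff_ssubset (hX.trans hM.1) hne)
      rw [ih m (S \ X) (by omega) (by omega)]

theorem slowCost_le {S : Finset V} {B : ℕ}
    (h : ∀ M ⊆ S, M.Nonempty → ∃ X ⊆ M, X.Nonempty ∧ IndepOn G X ∧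
      M.card + slowCost G (S \ X) ≤ B) : slowCost G S ≤ B := by
  rcases S.eq_empty_or_nonempty with rfl | hS
  · simp [slowCost, slowAux_empty]
  obtain ⟨n, hn⟩ : ∃ n, S.card = n + 1 := Nat.exists_eq_succ_of_ne_zero hS.card_pos.ne'
  simp only [slowCost, hn, slowAux]
  refine Finset.sup_le fun M hM => ?_
  rw [Finset.mem_filter, Finset.mem_powerset] at hM
  obtain ⟨X, hX, hne, hi, hB⟩ := h M hM.1 hM.2
  have hle : sInf {k : ℕ | ∃ X : Finset V, X ⊆ M ∧ X.Nonempty ∧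
      (∀ x ∈ X, ∀ y ∈ X, ¬ G.Adj x y) ∧ k = slowAux G n (S \ X)} ≤ slowAux G n (S \ X) :=
    Nat.sInf_le ⟨X, hX, hne, hi, rfl⟩
  refine le_trans (Nat.add_le_add_left hle _) ?_
  have hlt : (S \ X).card < S.card :=
    Finset.card_lt_card (Finset.sdiff_ssubset (hX.trans hM.1) hne)
  rwa [slowAux_eq_of_card_le G n (S \ X).card (S \ X) (by omega) le_rfl]

theorem exists_reply (G : SimpleGraph V) {S M : Finset V} (hM : M ⊆ S) (hne : M.Nonempty) :
    ∃ X ⊆ M, X.Nonempty ∧ IndepOn G X ∧ M.card + slowCost G (S \ X) ≤ slowCost G S := by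
  obtain ⟨n, hn⟩ : ∃ n, S.card = n + 1 :=
    Nat.exists_eq_succ_of_ne_zero (hne.mono hM).card_pos.ne'
  obtain ⟨x, hx⟩ := hne
  have hmem := Nat.sInf_mem (s := {k : ℕ | ∃ X : Finset V, X ⊆ M ∧ X.Nonempty ∧
      (∀ x ∈ X, ∀ y ∈ X, ¬ G.Adj x y) ∧ k = slowAux G n (S \ X)})
    ⟨_, {x}, by simpa using hx, by simp, IndepOn.singleton G x, rfl⟩
  obtain ⟨X, hX, hXne, hi, hk⟩ := hmem
  refine ⟨X, hX, hXne, hi, ?_⟩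
  have hlt : (S \ X).card < S.card :=
    Finset.card_lt_card (Finset.sdiff_ssubset (hX.trans hM) hXne)
  have hS : slowCost G S = slowAux G (n + 1) S := by rw [slowCost, hn]
  rw [hS, slowCost, slowAux_eq_of_card_le G (S \ X).card n (S \ X) le_rfl (by omega), ← hk]
  simp only [slowAux]
  exact Finset.le_sup (f := fun M : Finset V => M.card + sInf {k : ℕ | ∃ X : Finset V,
    X ⊆ M ∧ X.Nonempty ∧ (∀ x ∈ X, ∀ y ∈ X, ¬ G.Adj x y) ∧ k = slowAux G n (S \ X)})
    (show M ∈ S.powerset.filter fun M => M.Nonempty from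
      Finset.mem_filter.2 ⟨Finset.mem_powerset.2 hM, ⟨x, hx⟩⟩)

theorem slowCost_le_card_of_indepOn {S : Finset V} (hS : IndepOn G S) :
    slowCost G S ≤ S.card := by
  induction S using Finset.strongInduction with
  | H S ih =>
    refine slowCost_le fun M hM hne => ⟨M, subset_rfl, hne, fun x hx y hy => hS x (hM hx) y (hM hy), ?_⟩
    have h1 := ih (S \ M) (Finset.sdiff_ssubset hM hne) fun x hx y hy =>
      hS x (Finset.sdiff_subset hx) y (Finset.sdiff_subset hy)
    have h2 := Finset.card_sdiff_add_card_eq_card hM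
    omega

/-! ### The game on a union of parts -/

/-- If `V` is divided into parts by `g`, then the square root of the value of the game is
subadditive over the parts. -/
theorem slowCost_le_sq_sum_sqrt {ι : Type*} [DecidableEq ι] (I : Finset ι) (g : V → ι)
    (S : Finset V) (hg : ∀ v ∈ S, g v ∈ I) :
    (slowCost G S : ℝ) ≤ (∑ i ∈ I, √(slowCost G (S.filter (g · = i)) : ℝ)) ^ 2 := by
  induction S using Finset.strongInduction with
  | H S ih =>
    rw [← Nat.le_floor_iff (sq_nonneg _)]
    refine slowCost_le fun M hM hne => ?_
    set s : ι → ℝ := fun i => √(slowCost G (S.filter (g · = i)) : ℝ) with hs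
    set m : ι → ℝ := fun i => ((M.filter (g · = i)).card : ℝ) with hm
    have hMi : ∀ i, M.filter (g · = i) ⊆ S.filter (g · = i) :=
      fun i => Finset.filter_subset_filter _ hM
    have hs0 : ∀ i, 0 ≤ s i := fun i => Real.sqrt_nonneg _
    have hspos : ∀ i, 0 < m i → 0 < s i := by
      intro i hi
      have hi' : 0 < (M.filter (g · = i)).card := Nat.cast_pos.1 hi
      obtain ⟨X, -, -, -, hX⟩ := exists_reply G (hMi i) (Finset.card_pos.1 hi')
      refine Real.sqrt_pos.2 ?_
      have : 0 < slowCost G (S.filter (g · = i)) := by omega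
      exact_mod_cast this
    obtain ⟨i, hi, hmax⟩ := Finset.exists_max_image (I.filter fun i => 0 < m i)
      (fun i => m i / s i) (by
        obtain ⟨x, hx⟩ := hne
        refine ⟨g x, Finset.mem_filter.2 ⟨hg x (hM hx), ?_⟩⟩
        have : 0 < (M.filter (g · = g x)).card :=
          Finset.card_pos.2 ⟨x, Finset.mem_filter.2 ⟨hx, rfl⟩⟩
        exact Nat.cast_pos.2 this)
    rw [Finset.mem_filter] at hi
    obtain ⟨hiI, himpos⟩ := hi
    have hsi := hspos i himpos
    have hcross : ∀ j ∈ I, m j * s i ≤ m i * s j := by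
      intro j hj
      rcases (show 0 ≤ m j from Nat.cast_nonneg _).eq_or_lt with h0 | h0
      · rw [← h0, zero_mul]
        exact mul_nonneg himpos.le (hs0 j)
      · exact (div_le_div_iff₀ (hspos j h0) hsi).1 (hmax j (Finset.mem_filter.2 ⟨hj, h0⟩))
    have hMcard : (M.card : ℝ) = ∑ j ∈ I, m j := by
      rw [Finset.card_eq_sum_card_fiberwise (f := g) (t := I) fun v hv => hg v (hM hv)]
      push_cast
      rfl
    have hMs : (M.card : ℝ) * s i ≤ m i * ∑ j ∈ I, s j := by
      rw [hMcard, Finset.sum_mul, Finset.mul_sum]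
      exact Finset.sum_le_sum hcross
    obtain ⟨X, hX, hXne, hXi, hXc⟩ := exists_reply G (hMi i)
      (Finset.card_pos.1 (Nat.cast_pos.1 himpos))
    have hXM : X ⊆ M := hX.trans (Finset.filter_subset _ _)
    refine ⟨X, hXM, hXne, hXi, ?_⟩
    rw [Nat.le_floor_iff (sq_nonneg _)]
    push_cast
    have hrec := ih (S \ X) (Finset.sdiff_ssubset (hXM.trans hM) hXne)
      fun v hv => hg v (Finset.sdiff_subset hv)
    have hi' : (S \ X).filter (g · = i) = S.filter (g · = i) \ X := by
      ext v
      simp only [Finset.mem_filter, Finset.mem_sdiff]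
      tauto
    have hj' : ∀ j ∈ I.erase i, √(slowCost G ((S \ X).filter (g · = j)) : ℝ) = s j := by
      intro j hj
      have : (S \ X).filter (g · = j) = S.filter (g · = j) := by
        ext v
        simp only [Finset.mem_filter, Finset.mem_sdiff]
        refine ⟨fun h => ⟨h.1.1, h.2⟩, fun h => ⟨⟨h.1, fun hv => ?_⟩, h.2⟩⟩
        exact (Finset.mem_erase.1 hj).1 (h.2.symm.trans (Finset.mem_filter.1 (hX hv)).2)
      rw [this]
    rw [← Finset.add_sum_erase _ _ hiI, Finset.sum_congr rfl hj', hi'] at hrec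
    rw [← Finset.add_sum_erase _ s hiI] at hMs ⊢
    set R := ∑ j ∈ I.erase i, s j with hR
    have hR0 : 0 ≤ R := Finset.sum_nonneg fun j _ => hs0 j
    set t := √(slowCost G (S.filter (g · = i) \ X) : ℝ) with ht
    have ht0 : 0 ≤ t := Real.sqrt_nonneg _
    have hts : m i + t ^ 2 ≤ s i ^ 2 := by
      rw [ht, hs, Real.sq_sqrt (Nat.cast_nonneg _), Real.sq_sqrt (Nat.cast_nonneg _)]
      rw [hm, ← Nat.cast_add]
      exact Nat.cast_le.2 hXc
    have hle : t ≤ s i := by nlinarith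
    have hm2 : m i ≤ 2 * s i * (s i - t) := by nlinarith [sq_nonneg (s i - t)]
    have hkey : (M.card : ℝ) ≤ m i + 2 * R * (s i - t) := by
      refine le_of_mul_le_mul_right ?_ hsi
      nlinarith [mul_le_mul_of_nonneg_right hm2 hR0]
    nlinarith

/-! ### The game on forests -/

/-- `U` has a partition into pairwise nonadjacent blocks, exactly `j` of which have odd size. -/
inductive OddBlocks (G : SimpleGraph V) : Finset V → ℕ → Prop
  | empty : OddBlocks G ∅ 0
  | union {U B : Finset V} {j : ℕ} (hU : OddBlocks G U j) (hd : Disjoint U B)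
      (hn : NonAdj G U B) : OddBlocks G (U ∪ B) (j + B.card % 2)

namespace OddBlocks

variable {U U' : Finset V} {j j' : ℕ}

theorem le_card (h : OddBlocks G U j) : j ≤ U.card := by
  induction h with
  | empty => simp
  | union hU hd hn ih =>
    rw [Finset.card_union_of_disjoint hd]
    have := Nat.mod_le (Finset.card ‹_›) 2
    omega

theorem card_mod_two (h : OddBlocks G U j) : U.card % 2 = j % 2 := by
  induction h with
  | empty => simp
  | union hU hd hn ih =>
    rw [Finset.card_union_of_disjoint hd]
    omega

theorem append (h : OddBlocks G U j) (h' : OddBlocks G U' j') (hd : Disjoint U U')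
    (hn : NonAdj G U U') : OddBlocks G (U ∪ U') (j + j') := by
  induction h' with
  | empty => simpa using h
  | @union A B i hA hAB hnAB ih =>
    rw [← Finset.union_assoc, ← Nat.add_assoc]
    refine (ih (hd.mono_right Finset.subset_union_left)
      (hn.mono subset_rfl Finset.subset_union_left)).union ?_ ?_
    · exact Finset.disjoint_union_left.2 ⟨hd.mono_right Finset.subset_union_right, hAB⟩
    · intro x hx y hy
      rcases Finset.mem_union.1 hx with hx | hx
      · exact hn x hx y (Finset.mem_union_right _ hy)
      · exact hnAB x hx y hy

theorem block (G : SimpleGraph V) (U : Finset V) : OddBlocks G U (U.card % 2) := by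
  simpa using (OddBlocks.empty (G := G)).union (Finset.disjoint_empty_left U)
    (by simp [NonAdj])

end OddBlocks

/-- Every subset of `U` with a chosen vertex `v` and at least one further vertex divides into two
parts joined by at most one edge, which is incident with `v`. -/
def Splits (G : SimpleGraph V) (U : Finset V) : Prop :=
  ∀ S ⊆ U, ∀ v ∈ S, S ≠ {v} → ∃ A B : Finset V, ∃ c : V,
    v ∈ A ∧ c ∈ B ∧ Disjoint A B ∧ A ∪ B = S ∧ OnlyEdge G A B v c

theorem Splits.mono {U W : Finset V} (h : Splits G W) (hU : U ⊆ W) : Splits G U :=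
  fun S hS => h S (hS.trans hU)

theorem splits_of_isAcyclic {U : Finset V} {s : Set V} (hs : (U : Set V) ⊆ s)
    (hG : (G.induce s).IsAcyclic) : Splits G U := by
  classical
  intro S hSU v hv hne
  have hSs : ∀ x ∈ S, x ∈ s := fun x hx => hs (hSU hx)
  by_cases hadj : ∃ c ∈ S, G.Adj v c
  · obtain ⟨c, hc, hvc⟩ := hadj
    set H := (G.induce (S : Set V)) with hH
    have hHac : H.IsAcyclic :=
      hG.comap (SimpleGraph.induceHomOfLE G (fun x hx => hSs x hx)).toHom
        (SimpleGraph.induceHomOfLE G (fun x hx => hSs x hx)).injective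
    have hbr : ¬ (H.deleteEdges {s(⟨v, hv⟩, ⟨c, hc⟩)}).Reachable ⟨v, hv⟩ ⟨c, hc⟩ := by
      have := SimpleGraph.isAcyclic_iff_forall_adj_isBridge.1 hHac
        (show H.Adj ⟨v, hv⟩ ⟨c, hc⟩ from hvc)
      exact (SimpleGraph.isBridge_iff.1 this)
    set A := S.filter fun x => ∃ hx : x ∈ S,
      (H.deleteEdges {s(⟨v, hv⟩, ⟨c, hc⟩)}).Reachable ⟨v, hv⟩ ⟨x, hx⟩ with hA
    refine ⟨A, S \ A, c, ?_, ?_, Finset.disjoint_sdiff, ?_, ?_⟩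
    · exact Finset.mem_filter.2 ⟨hv, hv, SimpleGraph.Reachable.refl _⟩
    · exact Finset.mem_sdiff.2 ⟨hc, fun h => hbr (Finset.mem_filter.1 h).2.2⟩
    · exact Finset.union_sdiff_of_subset (Finset.filter_subset _ _)
    · intro x hx y hy hxy
      obtain ⟨_, _, hxr⟩ := Finset.mem_filter.1 hx
      obtain ⟨hyS, hyA⟩ := Finset.mem_sdiff.1 hy
      by_contra hcon
      refine hyA (Finset.mem_filter.2 ⟨hyS, hyS, hxr.trans (SimpleGraph.Adj.reachable ?_)⟩)
      rw [SimpleGraph.deleteEdges_adj]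
      refine ⟨hxy, fun he => ?_⟩
      simp only [Set.mem_singleton_iff, Sym2.eq_iff, Subtype.mk.injEq] at he
      rcases he with he | ⟨rfl, -⟩
      · exact hcon he
      · exact hbr hxr
  · push Not at hadj
    obtain ⟨c, hc, hcv⟩ : ∃ c ∈ S, c ≠ v := by
      by_contra! h
      exact hne (Finset.eq_singleton_iff_unique_mem.2 ⟨hv, h⟩)
    refine ⟨{v}, S \ {v}, c, by simp, by simp [hc, hcv], Finset.disjoint_sdiff,
      Finset.union_sdiff_of_subset (by simpa using hv), ?_⟩
    intro x hx y hy hxy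
    rw [Finset.mem_singleton.1 hx] at hxy
    exact absurd hxy (hadj y (Finset.mem_sdiff.1 hy).1)

/-- Removing some independent set of marked vertices of `S` that contains the root `v` yields
profit at least `r`. The profit counts three for each removed vertex, one for each odd block that
is left, and minus two for each marked vertex. -/
def RootRemoved (G : SimpleGraph V) (M S : Finset V) (v : V) (r : ℤ) : Prop :=
  ∃ X ⊆ M ∩ S, ∃ j : ℕ, IndepOn G X ∧ v ∈ X ∧ OddBlocks G (S \ X) j ∧
    r + 2 * (M ∩ S).card ≤ 3 * X.card + j

/-- Removing some independent set of marked vertices of `S` that does not contain the root `v`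
yields profit at least `p`, not counting the block of `v`, whose size has parity `b`. -/
def RootKept (G : SimpleGraph V) (M S : Finset V) (v : V) (p : ℤ) (b : ℕ) : Prop :=
  ∃ X ⊆ M ∩ S, ∃ R O : Finset V, ∃ j : ℕ, IndepOn G X ∧ v ∈ R ∧ R ∪ O = S \ X ∧
    Disjoint R O ∧ NonAdj G O R ∧ OddBlocks G O j ∧ R.card % 2 = b ∧
    p + 2 * (M ∩ S).card ≤ 3 * X.card + j

section Merge

variable {M A B : Finset V} {v c : V}

theorem card_inter_union (hd : Disjoint A B) :
    (M ∩ (A ∪ B)).card = (M ∩ A).card + (M ∩ B).card := by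
  rw [Finset.inter_union_distrib_left, Finset.card_union_of_disjoint
    (hd.mono Finset.inter_subset_right Finset.inter_subset_right)]

theorem union_sdiff_union {X Y : Finset V} (hd : Disjoint A B) (hX : X ⊆ A) (hY : Y ⊆ B) :
    (A ∪ B) \ (X ∪ Y) = A \ X ∪ B \ Y := by
  ext x
  have h1 := @hX x
  have h2 := @hY x
  have h3 : x ∈ A → x ∉ B := fun h => Finset.disjoint_left.1 hd h
  simp only [Finset.mem_union, Finset.mem_sdiff]
  tauto

theorem NonAdj.union_left {C : Finset V} (h : NonAdj G A C) (h' : NonAdj G B C) :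
    NonAdj G (A ∪ B) C := by
  intro x hx
  rcases Finset.mem_union.1 hx with hx | hx
  · exact h x hx
  · exact h' x hx

theorem RootRemoved.merge_kept {r p : ℤ} {b : ℕ} (hd : Disjoint A B) (he : OnlyEdge G A B v c)
    (h1 : RootRemoved G M A v r) (h2 : RootKept G M B c p b) :
    RootRemoved G M (A ∪ B) v (r + p + b) := by
  obtain ⟨X, hX, j, hXi, hvX, hXj, hr⟩ := h1
  obtain ⟨Y, hY, R, O, i, hYi, hcR, hRO, hROd, hROn, hOi, hb, hp⟩ := h2
  have hXA : X ⊆ A := hX.trans Finset.inter_subset_right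
  have hYB : Y ⊆ B := hY.trans Finset.inter_subset_right
  have hcY : c ∉ Y := by
    have : c ∈ B \ Y := hRO ▸ Finset.mem_union_left _ hcR
    exact (Finset.mem_sdiff.1 this).2
  refine ⟨X ∪ Y, ?_, j + (i + R.card % 2), hXi.union hYi (he.nonAdj_right hXA hYB hcY),
    Finset.mem_union_left _ hvX, ?_, ?_⟩
  · rw [Finset.inter_union_distrib_left]
    exact Finset.union_subset_union hX hY
  · rw [union_sdiff_union hd hXA hYB]
    refine hXj.append ?_ (hd.mono Finset.sdiff_subset Finset.sdiff_subset)
      (he.nonAdj_left Finset.sdiff_subset Finset.sdiff_subset (by simp [hvX]))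
    rw [← hRO, Finset.union_comm]
    exact hOi.union hROd.symm hROn
  · rw [card_inter_union hd, Finset.card_union_of_disjoint (hd.mono hXA hYB)]
    push_cast
    omega

theorem RootKept.merge_removed {r p : ℤ} {b : ℕ} (hd : Disjoint A B) (he : OnlyEdge G A B v c)
    (h1 : RootKept G M A v p b) (h2 : RootRemoved G M B c r) :
    RootKept G M (A ∪ B) v (p + r) b := by
  obtain ⟨X, hX, R, O, i, hXi, hvR, hRO, hROd, hROn, hOi, hb, hp⟩ := h1
  obtain ⟨Y, hY, j, hYi, hcY, hYj, hr⟩ := h2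
  have hXA : X ⊆ A := hX.trans Finset.inter_subset_right
  have hYB : Y ⊆ B := hY.trans Finset.inter_subset_right
  have hvX : v ∉ X := by
    have : v ∈ A \ X := hRO ▸ Finset.mem_union_left _ hvR
    exact (Finset.mem_sdiff.1 this).2
  have hRA : R ⊆ A := (Finset.subset_union_left.trans hRO.subset).trans Finset.sdiff_subset
  have hOA : O ⊆ A := (Finset.subset_union_right.trans hRO.subset).trans Finset.sdiff_subset
  refine ⟨X ∪ Y, ?_, R, O ∪ B \ Y, i + j, hXi.union hYi (he.nonAdj_left hXA hYB hvX), hvR,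
    ?_, ?_, ?_, ?_, hb, ?_⟩
  · rw [Finset.inter_union_distrib_left]
    exact Finset.union_subset_union hX hY
  · rw [union_sdiff_union hd hXA hYB, ← hRO, Finset.union_assoc]
  · exact Finset.disjoint_union_right.2 ⟨hROd, hd.mono hRA Finset.sdiff_subset⟩
  · exact hROn.union_left (he.nonAdj_right hRA Finset.sdiff_subset (by simp [hcY])).symm
  · exact hOi.append hYj (hd.mono hOA Finset.sdiff_subset)
      (he.nonAdj_right hOA Finset.sdiff_subset (by simp [hcY]))
  · rw [card_inter_union hd, Finset.card_union_of_disjoint (hd.mono hXA hYB)]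
    push_cast
    omega

theorem RootKept.merge_kept {p q : ℤ} {b d : ℕ} (hd : Disjoint A B) (he : OnlyEdge G A B v c)
    (h1 : RootKept G M A v p b) (h2 : RootKept G M B c q d) :
    RootKept G M (A ∪ B) v (p + q) ((b + d) % 2) := by
  obtain ⟨X, hX, R, O, i, hXi, hvR, hRO, hROd, hROn, hOi, hb, hp⟩ := h1
  obtain ⟨Y, hY, R', O', j, hYi, hcR, hRO', hROd', hROn', hOj, hb', hq⟩ := h2
  have hXA : X ⊆ A := hX.trans Finset.inter_subset_right
  have hYB : Y ⊆ B := hY.trans Finset.inter_subset_right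
  have hvX : v ∉ X := by
    have : v ∈ A \ X := hRO ▸ Finset.mem_union_left _ hvR
    exact (Finset.mem_sdiff.1 this).2
  have hRA : R ⊆ A := (Finset.subset_union_left.trans hRO.subset).trans Finset.sdiff_subset
  have hOA : O ⊆ A := (Finset.subset_union_right.trans hRO.subset).trans Finset.sdiff_subset
  have hRB : R' ⊆ B := (Finset.subset_union_left.trans hRO'.subset).trans Finset.sdiff_subset
  have hOB : O' ⊆ B := (Finset.subset_union_right.trans hRO'.subset).trans Finset.sdiff_subset
  have hvO : v ∉ O := Finset.disjoint_left.1 hROd hvR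
  have hcO : c ∉ O' := Finset.disjoint_left.1 hROd' hcR
  refine ⟨X ∪ Y, ?_, R ∪ R', O ∪ O', i + j, hXi.union hYi (he.nonAdj_left hXA hYB hvX),
    Finset.mem_union_left _ hvR, ?_, ?_, ?_, ?_, ?_, ?_⟩
  · rw [Finset.inter_union_distrib_left]
    exact Finset.union_subset_union hX hY
  · rw [union_sdiff_union hd hXA hYB, ← hRO, ← hRO', Finset.union_union_union_comm]
  · simp only [Finset.disjoint_union_left, Finset.disjoint_union_right]
    exact ⟨⟨hROd, (hd.mono hOA hRB).symm⟩, hd.mono hRA hOB, hROd'⟩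
  · refine NonAdj.symm (NonAdj.union_left (NonAdj.symm ?_) (NonAdj.symm ?_))
    · exact hROn.union_left (he.nonAdj_right hRA hOB hcO).symm
    · exact (he.nonAdj_left hOA hRB hvO).union_left hROn'
  · exact hOi.append hOj (hd.mono hOA hOB) (he.nonAdj_left hOA hOB hvO)
  · rw [Finset.card_union_of_disjoint (hd.mono hRA hRB)]
    omega
  · rw [card_inter_union hd, Finset.card_union_of_disjoint (hd.mono hXA hYB)]
    push_cast
    omega

end Merge

/-- The profits available in a forest with a marked root `v`. -/
def MarkedRoot (G : SimpleGraph V) (M S : Finset V) (v : V) : Prop :=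
  ∃ r p : ℤ, ∃ b : ℕ, RootRemoved G M S v r ∧ RootKept G M S v p b ∧ 0 ≤ r + p + b

/-- The profit available in a forest with an unmarked root `v`. -/
def UnmarkedRoot (G : SimpleGraph V) (M S : Finset V) (v : V) : Prop :=
  ∃ p : ℤ, ∃ b : ℕ, RootKept G M S v p b ∧ 0 ≤ p

theorem RootKept.parity_le {M S : Finset V} {v : V} {p : ℤ} {b : ℕ}
    (h : RootKept G M S v p b) : b ≤ 1 := by
  obtain ⟨X, -, R, O, j, -, -, -, -, -, -, hb, -⟩ := h
  omega

theorem Splits.markedRoot_or_unmarkedRoot {S : Finset V} (hS : Splits G S) (M : Finset V) {v : V}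
    (hv : v ∈ S) : (v ∈ M → MarkedRoot G M S v) ∧ (v ∉ M → UnmarkedRoot G M S v) := by
  induction S using Finset.strongInduction generalizing v with
  | H S ih =>
    by_cases hne : S = {v}
    · subst hne
      refine ⟨fun hvM => ?_, fun hvM => ?_⟩
      · refine ⟨1, -2, 1, ⟨{v}, by simpa using hvM, 0, IndepOn.singleton G v, by simp, ?_, ?_⟩,
          ⟨∅, by simp, {v}, ∅, 0, by simp [IndepOn], by simp, by simp, by simp, by simp [NonAdj],
            OddBlocks.empty, by simp, ?_⟩, by norm_num⟩
        · simpa using OddBlocks.empty (G := G)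
        · simp [hvM]
        · simp [hvM]
      · exact ⟨0, 1, ⟨∅, by simp, {v}, ∅, 0, by simp [IndepOn], by simp, by simp, by simp,
          by simp [NonAdj], OddBlocks.empty, by simp, by simp [hvM]⟩, le_rfl⟩
    · obtain ⟨A, B, c, hvA, hcB, hd, rfl, he⟩ := hS S subset_rfl v hv hne
      have hA : A ⊂ A ∪ B := Finset.ssubset_iff_subset_ne.2 ⟨Finset.subset_union_left, fun h =>
        Finset.disjoint_left.1 hd (h ▸ Finset.mem_union_right _ hcB) hcB⟩
      have hB : B ⊂ A ∪ B := Finset.ssubset_iff_subset_ne.2 ⟨Finset.subset_union_right, fun h =>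
        Finset.disjoint_left.1 hd hvA (h ▸ Finset.mem_union_left _ hvA)⟩
      have ihA := ih A hA (hS.mono hA.1) hvA
      have ihB := ih B hB (hS.mono hB.1) hcB
      refine ⟨fun hvM => ?_, fun hvM => ?_⟩
      · obtain ⟨r, p, b, hr, hp, h0⟩ := ihA.1 hvM
        have hb := hp.parity_le
        by_cases hcM : c ∈ M
        · obtain ⟨r', p', b', hr', hp', h0'⟩ := ihB.1 hcM
          exact ⟨_, _, _, hr.merge_kept hd he hp', hp.merge_removed hd he hr', by omega⟩
        · obtain ⟨p', b', hp', h0'⟩ := ihB.2 hcM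
          have hb' := hp'.parity_le
          exact ⟨_, _, _, hr.merge_kept hd he hp', hp.merge_kept hd he hp', by omega⟩
      · obtain ⟨p, b, hp, h0⟩ := ihA.2 hvM
        by_cases hcM : c ∈ M
        · obtain ⟨r', p', b', hr', hp', h0'⟩ := ihB.1 hcM
          have hb' := hp'.parity_le
          by_cases hr0 : 0 ≤ r'
          · exact ⟨_, _, hp.merge_removed hd he hr', by omega⟩
          · exact ⟨_, _, hp.merge_kept hd he hp', by omega⟩
        · obtain ⟨p', b', hp', h0'⟩ := ihB.2 hcM
          exact ⟨_, _, hp.merge_kept hd he hp', by omega⟩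

theorem RootKept.exists_reply {M S : Finset V} {v : V} {p : ℤ} {b : ℕ}
    (h : RootKept G M S v p b) : ∃ X ⊆ M ∩ S, ∃ j : ℕ, IndepOn G X ∧ OddBlocks G (S \ X) j ∧
      p + b + 2 * (M ∩ S).card ≤ 3 * X.card + j := by
  obtain ⟨X, hX, R, O, j, hXi, -, hRO, hd, hn, hO, rfl, hp⟩ := h
  refine ⟨X, hX, j + R.card % 2, hXi, ?_, by push_cast; omega⟩
  rw [← hRO, Finset.union_comm]
  exact hO.union hd.symm hn

theorem Splits.exists_reply_of_block {S : Finset V} (hS : Splits G S) (M : Finset V) :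
    ∃ X ⊆ M ∩ S, ∃ j : ℕ, IndepOn G X ∧ OddBlocks G (S \ X) j ∧
      2 * (M ∩ S).card + S.card % 2 ≤ 3 * X.card + j := by
  rcases S.eq_empty_or_nonempty with rfl | ⟨v, hv⟩
  · exact ⟨∅, by simp, 0, by simp [IndepOn], by simpa using OddBlocks.empty, by simp⟩
  suffices h : ∃ X ⊆ M ∩ S, ∃ j : ℕ, IndepOn G X ∧ OddBlocks G (S \ X) j ∧
      2 * (M ∩ S).card ≤ 3 * X.card + j by
    obtain ⟨X, hX, j, hXi, hj, hle⟩ := h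
    refine ⟨X, hX, j, hXi, hj, ?_⟩
    have h1 := hj.card_mod_two
    have h2 := Finset.card_sdiff_add_card_eq_card (hX.trans Finset.inter_subset_right)
    omega
  obtain ⟨hmarked, hunmarked⟩ := hS.markedRoot_or_unmarkedRoot M hv
  by_cases hvM : v ∈ M
  · obtain ⟨r, p, b, hr, hp, h0⟩ := hmarked hvM
    by_cases hr0 : 0 ≤ r
    · obtain ⟨X, hX, j, hXi, -, hj, hle⟩ := hr
      exact ⟨X, hX, j, hXi, hj, by omega⟩
    · obtain ⟨X, hX, j, hXi, hj, hle⟩ := hp.exists_reply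
      exact ⟨X, hX, j, hXi, hj, by omega⟩
  · obtain ⟨p, b, hp, h0⟩ := hunmarked hvM
    obtain ⟨X, hX, j, hXi, hj, hle⟩ := hp.exists_reply
    exact ⟨X, hX, j, hXi, hj, by omega⟩

theorem OddBlocks.exists_reply {U : Finset V} {j : ℕ} (h : OddBlocks G U j) (hU : Splits G U)
    (M : Finset V) : ∃ X ⊆ M ∩ U, ∃ i : ℕ, IndepOn G X ∧ OddBlocks G (U \ X) i ∧
      2 * (M ∩ U).card + j ≤ 3 * X.card + i := by
  induction h with
  | empty => exact ⟨∅, by simp, 0, by simp [IndepOn], by simpa using OddBlocks.empty, by simp⟩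
  | @union U B j _ hd hn ih =>
    obtain ⟨X, hX, i, hXi, hi, hle⟩ := ih (hU.mono Finset.subset_union_left)
    obtain ⟨Y, hY, i', hYi, hi', hle'⟩ :=
      (hU.mono Finset.subset_union_right).exists_reply_of_block M
    have hXU : X ⊆ U := hX.trans Finset.inter_subset_right
    have hYB : Y ⊆ B := hY.trans Finset.inter_subset_right
    refine ⟨X ∪ Y, ?_, i + i', hXi.union hYi (hn.mono hXU hYB), ?_, ?_⟩
    · rw [Finset.inter_union_distrib_left]
      exact Finset.union_subset_union hX hY
    · rw [union_sdiff_union hd hXU hYB]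
      exact hi.append hi' (hd.mono Finset.sdiff_subset Finset.sdiff_subset)
        (hn.mono Finset.sdiff_subset Finset.sdiff_subset)
    · rw [card_inter_union hd, Finset.card_union_of_disjoint (hd.mono hXU hYB)]
      omega

theorem Splits.two_mul_slowCost_add_le {U : Finset V} (hU : Splits G U) {j : ℕ}
    (hj : OddBlocks G U j) : 2 * slowCost G U + j ≤ 3 * U.card := by
  classical
  induction U using Finset.strongInduction generalizing j with
  | H U ih =>
    set m := Nat.findGreatest (OddBlocks G U) U.card with hm
    have hmax : ∀ i, OddBlocks G U i → i ≤ m := fun i hi => Nat.le_findGreatest hi.le_card hi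
    have hmU : OddBlocks G U m := Nat.findGreatest_spec hj.le_card hj
    have hjm := hmax j hj
    have hmc := hmU.le_card
    have hcost : slowCost G U ≤ (3 * U.card - m) / 2 := by
      refine slowCost_le fun M hM hne => ?_
      obtain ⟨X, hX, i, hXi, hi, hle⟩ := hmU.exists_reply hU M
      rw [Finset.inter_eq_left.2 hM] at hX hle
      have hMpos := hne.card_pos
      have hXne : X.Nonempty := by
        by_contra h0
        rw [Finset.not_nonempty_iff_eq_empty] at h0
        subst h0
        rw [Finset.sdiff_empty] at hi
        have := hmax i hi
        simp only [Finset.card_empty] at hle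
        omega
      refine ⟨X, hX, hXne, hXi, ?_⟩
      have hrec := ih (U \ X) (Finset.sdiff_ssubset (hX.trans hM) hXne)
        (hU.mono Finset.sdiff_subset) hi
      have hcard := Finset.card_sdiff_add_card_eq_card (hX.trans hM)
      omega
    omega

theorem slowCost_le_of_isAcyclic {U : Finset V} {s : Set V} (hs : (U : Set V) ⊆ s)
    (hG : (G.induce s).IsAcyclic) : (slowCost G U : ℝ) ≤ 3 / 2 * U.card := by
  have h := (splits_of_isAcyclic hs hG).two_mul_slowCost_add_le (OddBlocks.block G U)
  have h' : 2 * slowCost G U ≤ 3 * U.card := by omega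
  have h'' : (2 : ℝ) * slowCost G U ≤ 3 * U.card := by exact_mod_cast h'
  linarith

end

/-! ### Acyclic colorings -/

theorem sq_weighted_add_le {A B c d : ℝ} (hB : 0 ≤ B) (hc : 0 ≤ c) (hcd : c ≤ d)
    (hAB : d * B ≤ A) :
    (1 + d ^ 2) * (c * A + B) ^ 2 ≤ (c * d + 1) ^ 2 * (A ^ 2 + B ^ 2) := by
  have hd : 0 ≤ d := hc.trans hcd
  have h1 : 0 ≤ 2 * c * d + 1 - c ^ 2 := by nlinarith [mul_nonneg hc (sub_nonneg.2 hcd)]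
  have h2 : 0 ≤ 2 * (d - c) * (c * d + 1) * B := by
    have := sub_nonneg.2 hcd
    positivity
  have h3 : 0 ≤ (2 * c * d + 1 - c ^ 2) * A - (c ^ 2 * d + 2 * c - d) * B := by
    nlinarith [mul_le_mul_of_nonneg_left hAB h1]
  nlinarith [mul_nonneg (sub_nonneg.2 hAB) h3]

theorem sum_sqrt_add_sqrt_sq_le {r : ℕ} {n x : ℝ} (y : ℕ → ℝ) (hx : 0 ≤ x)
    (hy : ∀ i ∈ Finset.range r, 0 ≤ y i) (hn : ∑ i ∈ Finset.range r, y i + x = n)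
    (hxn : (2 * r + 1) * x ≤ n) :
    (∑ i ∈ Finset.range r, √(3 / 2 * y i) + √x) ^ 2 ≤
      1 / (2 * r + 1) * (√(3 / 4) * (2 * r) + 1) ^ 2 * n := by
  have hr : (0 : ℝ) ≤ r := Nat.cast_nonneg r
  have hY : 0 ≤ n - x := by nlinarith
  set A := √(n - x) with hA
  set B := √x with hB
  have hA2 : A ^ 2 = n - x := Real.sq_sqrt hY
  have hB2 : B ^ 2 = x := Real.sq_sqrt hx
  set c := √(3 / 2 * r) with hc
  set d := √(2 * r) with hd
  have hc2 : c ^ 2 = 3 / 2 * r := Real.sq_sqrt (by positivity)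
  have hd2 : d ^ 2 = 2 * r := Real.sq_sqrt (by positivity)
  have hcd : c * d = √(3 / 4) * (2 * r) := by
    rw [hc, hd, ← Real.sqrt_mul (by positivity),
      show (3 / 2 * r * (2 * r) : ℝ) = 3 / 4 * (2 * r) ^ 2 by ring,
      Real.sqrt_mul (by norm_num), Real.sqrt_sq (by positivity)]
  have hsum : ∑ i ∈ Finset.range r, √(3 / 2 * y i) ≤ c * A := by
    rw [hc, hA, ← Real.sqrt_mul (by positivity)]
    refine Real.le_sqrt_of_sq_le (sq_sum_le_card_mul_sum_sq.trans ?_)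
    rw [Finset.sum_congr rfl fun i hi =>
      Real.sq_sqrt (show 0 ≤ 3 / 2 * y i by have := hy i hi; positivity), ← Finset.mul_sum,
      Finset.card_range, ← hn]
    exact le_of_eq (by ring)
  have hdB : d * B ≤ A := by
    rw [hd, hB, hA, ← Real.sqrt_mul (by positivity)]
    exact Real.sqrt_le_sqrt (by linarith)
  have hkey := sq_weighted_add_le (Real.sqrt_nonneg x) (Real.sqrt_nonneg (3 / 2 * (r : ℝ)))
    (Real.sqrt_le_sqrt (show 3 / 2 * (r : ℝ) ≤ 2 * r by linarith)) hdB
  rw [hA2, hB2, hd2, sub_add_cancel, ← hc, ← hd, ← hB, hcd] at hkey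
  have hpos : (0 : ℝ) < 2 * r + 1 := by positivity
  calc _ ≤ (c * A + B) ^ 2 := by
        have : 0 ≤ ∑ i ∈ Finset.range r, √(3 / 2 * y i) :=
          Finset.sum_nonneg fun i _ => Real.sqrt_nonneg _
        have : 0 ≤ B := Real.sqrt_nonneg _
        gcongr
    _ ≤ _ := by
        rw [mul_assoc, one_div, ← div_eq_inv_mul, le_div_iff₀ hpos]
        linarith

theorem stmt_9 {V : Type*} [Fintype V] [DecidableEq V] (G : SimpleGraph V)
    (k : ℕ) (hk : Odd k) (hacyc : AcyclicallyColorable G k) :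
    (slowCost G Finset.univ : ℝ) ≤
      (1 / k) * (Real.sqrt (3 / 4) * (k - 1) + 1) ^ 2 * Fintype.card V := by
  obtain ⟨r, rfl⟩ := hk
  obtain ⟨f, hproper, hforest⟩ := hacyc
  obtain ⟨l, -, hl⟩ := Finset.exists_min_image (Finset.univ : Finset (Fin (2 * r + 1)))
    (fun i => (Finset.univ.filter (f · = i)).card) Finset.univ_nonempty
  set σ : Equiv.Perm (Fin (2 * r + 1)) := Equiv.swap l (Fin.last (2 * r)) with hσ
  set g : V → ℕ := fun v => (σ (f v)).val / 2 with hg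
  set P : ℕ → Finset V := fun i => Finset.univ.filter (g · = i) with hP
  have hgr : ∀ v, g v ∈ Finset.range (r + 1) := by
    intro v
    have := (σ (f v)).isLt
    rw [Finset.mem_range]
    simp only [hg]
    omega
  have hlast : P r = Finset.univ.filter (f · = l) := by
    ext v
    simp only [hP, hg, Finset.mem_filter, Finset.mem_univ, true_and]
    rw [← σ.injective.eq_iff (b := l), hσ, Equiv.swap_apply_left, Fin.ext_iff, Fin.val_last]
    have := (Equiv.swap l (Fin.last (2 * r)) (f v)).isLt
    omega
  have hlastcost : (slowCost G (P r) : ℝ) ≤ (P r).card := by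
    refine Nat.cast_le.2 (slowCost_le_card_of_indepOn fun x hx y hy hxy => hproper x y hxy ?_)
    rw [hlast, Finset.mem_filter] at hx hy
    rw [hx.2, hy.2]
  have hcost : ∀ i ∈ Finset.range r, (slowCost G (P i) : ℝ) ≤ 3 / 2 * (P i).card := by
    intro i hi
    rw [Finset.mem_range] at hi
    refine slowCost_le_of_isAcyclic (fun v hv => ?_)
      (hforest (σ.symm ⟨2 * i, by omega⟩) (σ.symm ⟨2 * i + 1, by omega⟩))
    have hv' : (σ (f v)).val / 2 = i := (Finset.mem_filter.1 hv).2
    simp only [Set.mem_ofPred_eq, Equiv.eq_symm_apply, Fin.ext_iff]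
    omega
  have htotal : ∑ i ∈ Finset.range r, ((P i).card : ℝ) + (P r).card = Fintype.card V := by
    rw [← Finset.sum_range_succ (fun i => ((P i).card : ℝ)), ← Finset.card_univ,
      Finset.card_eq_sum_card_fiberwise (f := g) (t := Finset.range (r + 1)) fun v _ => hgr v]
    push_cast
    rfl
  have hmin : (2 * r + 1) * ((P r).card : ℝ) ≤ Fintype.card V := by
    have h := Finset.card_nsmul_le_sum Finset.univ
      (fun i => (Finset.univ.filter (f · = i)).card) _ hl
    rw [← Finset.card_eq_sum_card_fiberwise (f := f) (s := Finset.univ) (t := Finset.univ)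
      fun v _ => Finset.mem_univ _, ← hlast, Finset.card_univ, Finset.card_univ,
      Fintype.card_fin, smul_eq_mul] at h
    exact_mod_cast h
  have hsub := slowCost_le_sq_sum_sqrt (G := G) (Finset.range (r + 1)) g Finset.univ
    fun v _ => hgr v
  have hfinal := sum_sqrt_add_sqrt_sq_le (fun i => ((P i).card : ℝ)) (Nat.cast_nonneg _)
    (fun i _ => Nat.cast_nonneg _) htotal hmin
  push_cast
  rw [add_sub_cancel_right]
  refine (hsub.trans ?_).trans hfinal
  rw [Finset.sum_range_succ]
  have h0 : 0 ≤ ∑ i ∈ Finset.range r, √(slowCost G (P i) : ℝ) :=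
    Finset.sum_nonneg fun i _ => Real.sqrt_nonneg _
  have h1 : 0 ≤ √(slowCost G (P r) : ℝ) := Real.sqrt_nonneg _
  exact pow_le_pow_left₀ (add_nonneg h0 h1) (add_le_add
    (Finset.sum_le_sum fun i hi => Real.sqrt_le_sqrt (hcost i hi))
    (Real.sqrt_le_sqrt hlastcost)) 2
end
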